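/- arXiv:2001.06312 — 7 statements merged into one kernel-verified Lean document; each statement's English description precedes it below -/
import Mathlib

section
/- Let T be a set, Y ⊆ [0,1]^T and A a countable subset of Y. Then supp(x) ⊆ supp(A) for every x in the closure of A in [0,1]^T, and the projection π_{supp(A)} : [0,1]^T → [0,1]^{supp(A)} restricted to the closure of A is injective. -/
open Filter Topology

/-- A point of the closure of `A` vanishes wherever every element of `A` vanishes. -/
theorem support_subset_iUnion_of_mem_closure {T M : Type*} [Zero M] [TopologicalSpace M]
    [T1Space M] {A : Set (T → M)} {x : T → M} (hx : x ∈ closure A) :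
    {t : T | x t ≠ 0} ⊆ ⋃ a ∈ A, {t : T | a t ≠ 0} := by
  intro t ht
  have hU : IsOpen {y : T → M | y t ≠ 0} := isOpen_ne.preimage (continuous_apply t)
  obtain ⟨a, hat, haA⟩ := mem_closure_iff.mp hx _ hU ht
  exact Set.mem_biUnion haA hat

/-- Lemma 5.4: for a countable `A ⊆ Y ⊆ [0,1]^T`, every point of the closure of
`A` has support contained in `supp(A)`, and the projection `π_{supp(A)}` is injective on the
closure of `A`. -/
theorem statement8 {T : Type*} (Y : Set (T → unitInterval))
    (A : Set (T → unitInterval)) (hAY : A ⊆ Y) (hA : A.Countable) :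
    (∀ x ∈ closure A, {t : T | x t ≠ 0} ⊆ ⋃ a ∈ A, {t : T | a t ≠ 0}) ∧
    Set.InjOn (fun x : T → unitInterval => (⋃ a ∈ A, {t : T | a t ≠ 0}).restrict x)
      (closure A) := by
  refine ⟨fun x hx => support_subset_iUnion_of_mem_closure hx, fun x hx y hy hxy => ?_⟩
  funext t
  by_cases ht : t ∈ ⋃ a ∈ A, {t : T | a t ≠ 0}
  · exact congrFun hxy ⟨t, ht⟩
  · have hzero : ∀ z ∈ closure A, z t = 0 := fun z hz =>
      not_not.mp fun h => ht (support_subset_iUnion_of_mem_closure hz h)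
    rw [hzero x hx, hzero y hy]
end

section
/- Let X ⊆ [0,1]^T be a compact subspace such that Y = X ∩ Σ[0,1]^T is dense in X. Then the set Γ = {A ∈ [Y]^{≤ω} : π_{supp(A)}(X) = π_{supp(A)}(cl_X(A))} is cofinal in [Y]^{≤ω} ordered by inclusion: every countable subset A of Y is contained in some D ∈ Γ. -/
open Filter Topology

/-- `supp(A) = ⋃_{x ∈ A} supp(x)` for `A ⊆ [0,1]^T`. -/
def suppU {T : Type*} (A : Set (T → unitInterval)) : Set T := ⋃ a ∈ A, {t : T | a t ≠ 0}

theorem suppU_mono {T : Type*} {A B : Set (T → unitInterval)} (h : A ⊆ B) :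
    suppU A ⊆ suppU B :=
  Set.biUnion_subset_biUnion_left h

/-- On countably many coordinates, the closure of `Y` is approximated by a countable subset
of `Y`. -/
theorem exists_countable_approx_on_coords {T E : Type*} [TopologicalSpace E]
    [SecondCountableTopology E] (Y : Set (T → E)) {S : Set T} (hS : S.Countable) :
    ∃ C ⊆ Y, C.Countable ∧ ∀ x ∈ closure Y, ∀ (I : Finset T) (u : T → Set E), ↑I ⊆ S →
      (∀ i ∈ I, IsOpen (u i) ∧ x i ∈ u i) → ∃ c ∈ C, ∀ i ∈ I, c i ∈ u i := by
  have : Countable S := hS.to_subtype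
  let f : Y → S → E := fun y => S.domRestrict y.1
  let _ : TopologicalSpace Y := TopologicalSpace.induced f inferInstance
  have : SecondCountableTopology Y := TopologicalSpace.secondCountableTopology_induced _ _ f
  obtain ⟨s, hsc, hsd⟩ := TopologicalSpace.exists_countable_dense Y
  refine ⟨Subtype.val '' s, by rintro _ ⟨y, -, rfl⟩; exact y.2, hsc.image _, ?_⟩
  intro x hx I u hI hu
  obtain ⟨y, hyu, hy⟩ := mem_closure_iff.1 hx ((I : Set T).pi u)
    (isOpen_set_pi I.finite_toSet fun i hi => (hu i hi).1) fun i hi => (hu i hi).2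
  have hf : Continuous f := continuous_induced_dom
  have ho : IsOpen {z : Y | ∀ i ∈ I, z.1 i ∈ u i} := by
    have h : {z : Y | ∀ i ∈ I, z.1 i ∈ u i} = ⋂ i ∈ I, {z : Y | z.1 i ∈ u i} := by
      ext z; simp
    rw [h]
    refine isOpen_biInter_finset fun i hi => ?_
    exact (hu i hi).1.preimage ((continuous_apply (⟨i, hI hi⟩ : S)).comp hf)
  obtain ⟨z, hz, hzs⟩ := hsd.inter_open_nonempty _ ho ⟨⟨y, hy⟩, hyu⟩
  exact ⟨z.1, ⟨z, hzs, rfl⟩, hz⟩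

/-- Claim 1 of Proposition 5.5: if `X ⊆ [0,1]^T` is compact and
`Y = X ∩ Σ[0,1]^T` is dense in `X`, then
`Γ = {A ∈ [Y]^{≤ω} : π_{supp A}(X) = π_{supp A}(cl_X A)}` is cofinal in `[Y]^{≤ω}`. -/
theorem statement9 {T : Type*} (X : Set (T → unitInterval)) (hX : IsCompact X)
    (hd : X ⊆ closure (X ∩ {x : T → unitInterval | ({t : T | x t ≠ 0}).Countable})) :
    ∀ A : Set (T → unitInterval), A.Countable →
      A ⊆ X ∩ {x : T → unitInterval | ({t : T | x t ≠ 0}).Countable} →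
      ∃ D : Set (T → unitInterval), A ⊆ D ∧ D.Countable ∧
        D ⊆ X ∩ {x : T → unitInterval | ({t : T | x t ≠ 0}).Countable} ∧
        (fun x => (suppU D).restrict x) '' X =
          (fun x => (suppU D).restrict x) '' (closure D ∩ X) := by
  intro A hA hAY
  set Y := X ∩ {x : T → unitInterval | ({t : T | x t ≠ 0}).Countable}
  have step : ∀ B : {B : Set (T → unitInterval) // B.Countable ∧ B ⊆ Y},
      ∃ B' : {B : Set (T → unitInterval) // B.Countable ∧ B ⊆ Y}, B.1 ⊆ B'.1 ∧
        ∀ x ∈ closure Y, ∀ (I : Finset T) (u : T → Set unitInterval), ↑I ⊆ suppU B.1 →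
          (∀ i ∈ I, IsOpen (u i) ∧ x i ∈ u i) → ∃ c ∈ B'.1, ∀ i ∈ I, c i ∈ u i := by
    rintro ⟨B, hBc, hBY⟩
    obtain ⟨C, hCY, hCc, hC⟩ := exists_countable_approx_on_coords Y
      (hBc.biUnion fun b hb => (hBY hb).2 : (suppU B).Countable)
    refine ⟨⟨B ∪ C, hBc.union hCc, Set.union_subset hBY hCY⟩, Set.subset_union_left, ?_⟩
    intro x hx I u hI hu
    obtain ⟨c, hc, h⟩ := hC x hx I u hI hu
    exact ⟨c, Or.inr hc, h⟩
  choose next hsub happrox using step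
  let B : ℕ → {B : Set (T → unitInterval) // B.Countable ∧ B ⊆ Y} :=
    fun n => next^[n] ⟨A, hA, hAY⟩
  have hB : ∀ n, B (n + 1) = next (B n) := fun n => Function.iterate_succ_apply' _ _ _
  have hmono : Monotone fun n => (B n).1 :=
    monotone_nat_of_le_succ fun n => by rw [hB]; exact hsub _
  have hDY : (⋃ n, (B n).1) ⊆ Y := Set.iUnion_subset fun n => (B n).2.2
  refine ⟨⋃ n, (B n).1, Set.subset_iUnion (fun n => (B n).1) 0,
    Set.countable_iUnion fun n => (B n).2.1, hDY, ?_⟩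
  set D := ⋃ n, (B n).1 with hD
  have hDX : closure D ⊆ X :=
    closure_minimal (hDY.trans Set.inter_subset_left) hX.isClosed
  rw [Set.inter_eq_left.2 hDX]
  refine Set.Subset.antisymm ?_ (Set.image_mono hDX)
  have hcont : Continuous fun x : T → unitInterval => (suppU D).domRestrict x :=
    Pi.continuous_domRestrict _
  have hclosed : IsClosed ((fun x => (suppU D).domRestrict x) '' closure D) :=
    ((hX.of_isClosed_subset isClosed_closure hDX).image hcont).isClosed
  rintro _ ⟨x, hx, rfl⟩
  refine hclosed.closure_subset_iff.2 (Set.image_mono subset_closure)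
    (mem_closure_iff.2 fun o ho hxo => ?_)
  obtain ⟨I, u, hu, hIo⟩ := isOpen_pi_iff.1 ho _ hxo
  have hlevel : ∀ i : suppU D, ∃ n, i.1 ∈ suppU (B n).1 := by
    rintro ⟨i, hi⟩
    simp only [suppU, hD, Set.mem_iUnion] at hi ⊢
    obtain ⟨d, ⟨n, hn⟩, hd⟩ := hi
    exact ⟨n, d, hn, hd⟩
  choose n hn using hlevel
  classical
  obtain ⟨c, hc, hcu⟩ := happrox (B (I.sup n)) x (hd hx) (I.image Subtype.val)
    (fun t => if h : t ∈ suppU D then u ⟨t, h⟩ else Set.univ)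
    (by
      intro t ht
      obtain ⟨i, hi, rfl⟩ := Finset.mem_image.1 (Finset.mem_coe.1 ht)
      exact suppU_mono (hmono (Finset.le_sup hi)) (hn i))
    (by
      intro t ht
      obtain ⟨i, hi, rfl⟩ := Finset.mem_image.1 ht
      rw [dif_pos i.2]
      exact hu i hi)
  refine ⟨(suppU D).domRestrict c, hIo fun i hi => ?_, c, ?_, rfl⟩
  · simpa [Set.domRestrict] using hcu i.1 (Finset.mem_image_of_mem _ hi)
  · exact Set.mem_iUnion.2 ⟨I.sup n + 1, by rw [hB]; exact hc⟩
end

section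
/- Let X ⊆ [0,1]^T be a compact subspace such that Y = X ∩ Σ[0,1]^T is dense in X, and let Γ = {A ∈ [Y]^{≤ω} : π_{supp(A)}(X) = π_{supp(A)}(cl_X(A))}. Then Γ, ordered by inclusion, is σ-complete: for every ⊆-increasing sequence (A_n)_{n<ω} in Γ, the union ⋃_{n<ω} A_n belongs to Γ. -/
open Filter Topology

/-- Claim 2 of Proposition 5.5: the poset
`Γ = {A ∈ [Y]^{≤ω} : π_{supp A}(X) = π_{supp A}(cl_X A)}` is σ-complete: the union of an
increasing sequence of members of `Γ` is again in `Γ`. -/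
theorem statement10 {T : Type*} (X : Set (T → unitInterval)) (hX : IsCompact X)
    (hd : X ⊆ closure (X ∩ {x : T → unitInterval | ({t : T | x t ≠ 0}).Countable}))
    (A : ℕ → Set (T → unitInterval)) (hmono : Monotone A)
    (hA : ∀ n : ℕ, (A n).Countable ∧
      A n ⊆ X ∩ {x : T → unitInterval | ({t : T | x t ≠ 0}).Countable} ∧
      (fun x => (suppU (A n)).restrict x) '' X =
        (fun x => (suppU (A n)).restrict x) '' (closure (A n) ∩ X)) :
    (⋃ n, A n).Countable ∧
    (⋃ n, A n) ⊆ X ∩ {x : T → unitInterval | ({t : T | x t ≠ 0}).Countable} ∧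
    (fun x => (suppU (⋃ n, A n)).restrict x) '' X =
      (fun x => (suppU (⋃ n, A n)).restrict x) '' (closure (⋃ n, A n) ∩ X) := by
  refine ⟨Set.countable_iUnion fun n => (hA n).1, Set.iUnion_subset fun n => (hA n).2.1,
    Set.Subset.antisymm ?_ (Set.image_mono Set.inter_subset_right)⟩
  rintro _ ⟨x, hx, rfl⟩
  have h : ∀ n, ∃ y ∈ closure (A n) ∩ X, ∀ t ∈ suppU (A n), y t = x t := fun n => by
    obtain ⟨y, hy, hyx⟩ := (hA n).2.2.subset (Set.mem_image_of_mem _ hx)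
    exact ⟨y, hy, fun t ht => congrFun hyx ⟨t, ht⟩⟩
  choose y hy hyx using h
  have hK : IsCompact (closure (⋃ n, A n) ∩ X) := hX.inter_left isClosed_closure
  have hyK : ∀ n, y n ∈ closure (⋃ n, A n) ∩ X := fun n =>
    ⟨closure_mono (Set.subset_iUnion A n) (hy n).1, (hy n).2⟩
  obtain ⟨z, hz, hzy⟩ := hK (f := map y atTop)
    (tendsto_principal.2 (Eventually.of_forall hyK))
  refine ⟨z, hz, funext fun ⟨t, ht⟩ => ?_⟩
  obtain ⟨a, ha, hat⟩ := Set.mem_iUnion₂.1 ht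
  obtain ⟨m, hm⟩ := Set.mem_iUnion.1 ha
  have hclosed : IsClosed {w : T → unitInterval | w t = x t} :=
    isClosed_eq (continuous_apply t) continuous_const
  have hev : ∀ᶠ w in map y atTop, w t = x t := eventually_map.2 <|
    (eventually_ge_atTop m).mono fun n hn =>
      hyx n t (Set.mem_iUnion₂.2 ⟨a, hmono hn hm, hat⟩)
  exact isClosed_iff_clusterPt.1 hclosed z (hzy.mono (le_principal_iff.2 hev))
end

section
/- Every Valdivia compact space admits a π-skeleton: if X ⊆ [0,1]^T is compact and X ∩ Σ[0,1]^T is dense in X, then there exist an up-directed σ-complete partially ordered set Γ, a family {F_s : s ∈ Γ} of subspaces of X, and an ω-monotone function ψ : Γ → [T]^{≤ω} which generate a π-skeleton on X. -/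
open Filter Topology


/-- The pair `({F s : s ∈ Γ}, ψ)` generates a π-skeleton on the compact set
`X ⊆ [0,1]^T`. -/
structure IsPiSkeleton {T : Type*} (X : Set (T → unitInterval)) {Γ : Type*} [PartialOrder Γ]
    (F : Γ → Set (T → unitInterval)) (ψ : Γ → Set T) : Prop where
  directed : ∀ s t : Γ, ∃ u, s ≤ u ∧ t ≤ u
  sigma_complete : ∀ f : ℕ → Γ, Monotone f → ∃ u, IsLUB (Set.range f) u
  subset_X : ∀ s, F s ⊆ X
  /-- each `F s` is a cosmic (here: second countable) subspace of `X`. -/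
  cosmic : ∀ s, SecondCountableTopology ↥(F s)
  /-- (a) the family is increasing. -/
  mono : ∀ ⦃s t : Γ⦄, s ≤ t → F s ⊆ F t
  /-- (b) `⋃ s, F s` is dense in `X`. -/
  dense : X ⊆ closure (⋃ s, F s)
  countable : ∀ s, (ψ s).Countable
  /-- `ψ : Γ → [T]^{≤ω}` is ω-monotone: monotone … -/
  psi_mono : Monotone ψ
  /-- … and preserves suprema of increasing sequences. -/
  psi_omega : ∀ f : ℕ → Γ, Monotone f → ∀ u : Γ, IsLUB (Set.range f) u →
    ψ u = ⋃ n, ψ (f n)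
  /-- (c) the projection `π_{ψ s}` restricted to `F s` is a homeomorphism onto its image … -/
  embeds : ∀ s, Topology.IsEmbedding (fun x : ↥(F s) => (ψ s).restrict x.val)
  /-- … and `π_{ψ s}(X) = π_{ψ s}(F s)`. -/
  image_eq : ∀ s, (fun x => (ψ s).restrict x) '' X = (fun x => (ψ s).restrict x) '' (F s)

/-- Every subset of a space is approximated, through a map into a second countable space, by a
countable subset. -/
theorem exists_countable_image_subset_closure {α β : Type*} [TopologicalSpace β]
    [SecondCountableTopology β] (f : α → β) (A : Set α) :
    ∃ D ⊆ A, D.Countable ∧ f '' A ⊆ closure (f '' D) := by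
  obtain ⟨c, hc, hcd⟩ := TopologicalSpace.exists_countable_dense ↥(f '' A)
  choose g hgA hg using fun y : ↥(f '' A) => y.2
  refine ⟨g '' c, ?_, hc.image g, ?_⟩
  · rintro _ ⟨y, -, rfl⟩
    exact hgA y
  · have h : f '' (g '' c) = Subtype.val '' c := by
      rw [Set.image_image]
      exact Set.image_congr fun y _ => hg y
    rw [h]
    intro y hy
    exact closure_subtype.1 (hcd ⟨y, hy⟩)

/-- Setting the coordinates outside `S` to zero gives a point of the closed set `X` as soon as
each finite part of `S` can be approximated by points of `X` supported in `S`. -/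
theorem indicator_mem_of_forall_finite {T : Type*} {X : Set (T → unitInterval)} (hX : IsClosed X)
    {S : Set T} {x : T → unitInterval}
    (h : ∀ J : Finset T, ∀ u : T → Set unitInterval, (∀ i ∈ J, IsOpen (u i)) →
      (∀ i ∈ J, i ∈ S → x i ∈ u i) →
      ∃ d ∈ X, Function.support d ⊆ S ∧ ∀ i ∈ J, i ∈ S → d i ∈ u i) :
    S.indicator x ∈ X := by
  rw [← hX.closure_eq, mem_closure_iff]
  intro U hU hxU
  obtain ⟨J, u, hu, hJ⟩ := isOpen_pi_iff.1 hU _ hxU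
  obtain ⟨d, hdX, hdS, hd⟩ := h J u (fun i hi => (hu i hi).1) fun i hi hiS => by
    simpa [hiS] using (hu i hi).2
  refine ⟨d, hJ fun i hi => ?_, hdX⟩
  by_cases hiS : i ∈ S
  · exact hd i hi hiS
  · have h0 : d i = 0 := by
      by_contra hne
      exact hiS (hdS hne)
    simpa [hiS, h0] using (hu i hi).2

theorem exists_index_of_finset {T : Type*} {S : ℕ → Set T} (hS : Monotone S) (J : Finset T) :
    ∃ n, ∀ i ∈ J, i ∈ ⋃ n, S n → i ∈ S n := by
  classical
  obtain ⟨n, hn⟩ := hS.directed_le.exists_mem_subset_of_finset_subset_biUnion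
    (s := J.filter (· ∈ ⋃ n, S n)) (by
      intro i hi
      simpa using (Finset.mem_filter.1 hi).2)
  exact ⟨n, fun i hi hiS => hn (Finset.mem_filter.2 ⟨hi, hiS⟩)⟩

/-- The countable sets of coordinates which are invariant for `X`. -/
def InvariantIndex {T : Type*} (X : Set (T → unitInterval)) : Type _ :=
  {S : Set T // S.Countable ∧ ∀ x ∈ X, S.indicator x ∈ X}

instance {T : Type*} (X : Set (T → unitInterval)) : PartialOrder (InvariantIndex X) :=
  inferInstanceAs (PartialOrder {S : Set T // S.Countable ∧ ∀ x ∈ X, S.indicator x ∈ X})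

theorem indicator_iUnion_mem {T : Type*} {X : Set (T → unitInterval)} (hX : IsClosed X)
    {S : ℕ → Set T} (hS : Monotone S) (h : ∀ n, ∀ x ∈ X, (S n).indicator x ∈ X) :
    ∀ x ∈ X, (⋃ n, S n).indicator x ∈ X := by
  intro x hx
  refine indicator_mem_of_forall_finite hX fun J u _ hxu => ?_
  obtain ⟨n, hn⟩ := exists_index_of_finset hS J
  refine ⟨_, h n x hx, Set.support_indicator_subset.trans (Set.subset_iUnion S n), ?_⟩
  intro i hi hiS
  simpa [hn i hi hiS] using hxu i hi hiS

theorem InvariantIndex.isLUB_iUnion {T : Type*} {X : Set (T → unitInterval)} (hX : IsClosed X)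
    {f : ℕ → InvariantIndex X} (hf : Monotone f) :
    ∃ u : InvariantIndex X, u.1 = ⋃ n, (f n).1 ∧ IsLUB (Set.range f) u := by
  refine ⟨⟨⋃ n, (f n).1, Set.countable_iUnion fun n => (f n).2.1,
    indicator_iUnion_mem hX (fun _ _ h => hf h) fun n => (f n).2.2⟩, rfl, ?_, ?_⟩
  · rintro _ ⟨n, rfl⟩
    exact Set.subset_iUnion (fun n => (f n).1) n
  · intro v hv
    exact Set.iUnion_subset fun n => hv ⟨n, rfl⟩

theorem exists_invariantIndex_superset {T : Type*} {X : Set (T → unitInterval)} (hX : IsClosed X)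
    (hd : X ⊆ closure (X ∩ {x : T → unitInterval | ({t : T | x t ≠ 0}).Countable}))
    {A : Set T} (hA : A.Countable) : ∃ S : InvariantIndex X, A ⊆ S.1 := by
  have hD : ∀ S : {S : Set T // S.Countable}, ∃ D ⊆ X ∩ {x | ({t : T | x t ≠ 0}).Countable},
      D.Countable ∧ S.1.domRestrict '' X ⊆ closure (S.1.domRestrict '' D) := by
    intro S
    have := S.2.to_subtype
    obtain ⟨D, hDX, hDc, hDd⟩ := exists_countable_image_subset_closure
      (S.1.domRestrict (π := fun _ => unitInterval)) (X ∩ {x | ({t : T | x t ≠ 0}).Countable})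
    refine ⟨D, hDX, hDc, (Set.image_mono hd).trans ?_⟩
    exact (image_closure_subset_closure_image (Pi.continuous_domRestrict S.1)).trans
      (closure_minimal hDd isClosed_closure)
  choose D hDX hDc hDd using hD
  let next (S : {S : Set T // S.Countable}) : {S : Set T // S.Countable} :=
    ⟨S.1 ∪ ⋃ x ∈ D S, {t | x t ≠ 0},
      S.2.union ((hDc S).biUnion fun x hx => (hDX S hx).2)⟩
  let S (n : ℕ) : {S : Set T // S.Countable} := next^[n] ⟨A, hA⟩
  have hnext : ∀ n, S (n + 1) = next (S n) := fun n => Function.iterate_succ_apply' _ _ _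
  have hS : Monotone fun n => (S n).1 := monotone_nat_of_le_succ fun n => by
    simp only [hnext]
    exact Set.subset_union_left
  refine ⟨⟨⋃ n, (S n).1, Set.countable_iUnion fun n => (S n).2, fun x hx => ?_⟩,
    Set.subset_iUnion (fun n => (S n).1) 0⟩
  refine indicator_mem_of_forall_finite hX fun J u hu hxu => ?_
  obtain ⟨n, hn⟩ := exists_index_of_finset hS J
  have hopen : IsOpen ({i : ↥(S n).1 | i.1 ∈ J}.pi fun i => u i.1) :=
    isOpen_set_pi (J.finite_toSet.preimage Subtype.val_injective.injOn) fun i hi => hu i.1 hi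
  obtain ⟨_, hdu, d, hdD, rfl⟩ := mem_closure_iff.1 (hDd (S n) ⟨x, hx, rfl⟩) _ hopen
    fun i hi => hxu i.1 hi (Set.mem_iUnion.2 ⟨n, i.2⟩)
  refine ⟨d, (hDX _ hdD).1, fun t ht => Set.mem_iUnion.2 ⟨n + 1, ?_⟩, fun i hi hiS => ?_⟩
  · rw [hnext]
    exact Or.inr (Set.mem_biUnion hdD ht)
  · exact hdu ⟨i, hn i hi hiS⟩ hi

theorem isEmbedding_restrict_of_support_subset {T : Type*} (S : Set T)
    (F : Set (T → unitInterval)) (hF : ∀ x ∈ F, Function.support x ⊆ S) :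
    Topology.IsEmbedding (fun x : ↥F => S.domRestrict x.val) := by
  classical
  let g : (S → unitInterval) → T → unitInterval := fun z t => if h : t ∈ S then z ⟨t, h⟩ else 0
  have hg : Continuous g := continuous_pi fun t => by
    by_cases h : t ∈ S
    · simpa [g, h] using continuous_apply (⟨t, h⟩ : S)
    · simpa [g, h] using continuous_const
  refine Topology.IsEmbedding.of_comp ((Pi.continuous_domRestrict S).comp continuous_subtype_val)
    hg ?_
  convert Topology.IsEmbedding.subtypeVal (p := (· ∈ F)) using 1
  funext x t
  by_cases h : t ∈ S
  · simp [g, h, Set.domRestrict]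
  · have h0 : x.1 t = 0 := by
      by_contra hne
      exact h (hF x.1 x.2 hne)
    simp [g, h, h0]

/-- Proposition 5.5: every Valdivia compact space admits a π-skeleton. -/
theorem statement11 {T : Type u} (X : Set (T → unitInterval)) (hX : IsCompact X)
    (hd : X ⊆ closure (X ∩ {x : T → unitInterval | ({t : T | x t ≠ 0}).Countable})) :
    ∃ (Γ : Type u) (_ : PartialOrder Γ) (F : Γ → Set (T → unitInterval)) (ψ : Γ → Set T),
      IsPiSkeleton X F ψ := by
  have hXc := hX.isClosed
  have hemb (S : InvariantIndex X) := isEmbedding_restrict_of_support_subset S.1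
    {x | x ∈ X ∧ Function.support x ⊆ S.1} fun x hx => hx.2
  refine ⟨InvariantIndex X, inferInstance, fun S => {x | x ∈ X ∧ Function.support x ⊆ S.1},
    fun S => S.1, ?_⟩
  exact
    { directed := fun s t => by
        obtain ⟨u, hu⟩ := exists_invariantIndex_superset hXc hd (s.2.1.union t.2.1)
        exact ⟨u, Set.subset_union_left.trans hu, Set.subset_union_right.trans hu⟩
      sigma_complete := fun f hf => by
        obtain ⟨u, -, hu⟩ := InvariantIndex.isLUB_iUnion hXc hf
        exact ⟨u, hu⟩
      subset_X := fun s x hx => hx.1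
      cosmic := fun s => by
        have := s.2.1.to_subtype
        exact (hemb s).secondCountableTopology
      mono := fun s t hst x hx => ⟨hx.1, hx.2.trans hst⟩
      dense := hd.trans (closure_mono fun x hx => by
        obtain ⟨u, hu⟩ := exists_invariantIndex_superset hXc hd hx.2
        exact Set.mem_iUnion.2 ⟨u, hx.1, hu⟩)
      countable := fun s => s.2.1
      psi_mono := fun s t hst => hst
      psi_omega := fun f hf u hu => by
        obtain ⟨v, hv, hvlub⟩ := InvariantIndex.isLUB_iUnion hXc hf
        rw [hu.unique hvlub, hv]
      embeds := hemb
      image_eq := fun s => by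
        refine Set.Subset.antisymm ?_ (Set.image_mono fun x hx => hx.1)
        rintro _ ⟨x, hx, rfl⟩
        exact ⟨s.1.indicator x, ⟨s.2.2 x hx, Set.support_indicator_subset⟩,
          funext fun t => Set.indicator_of_mem t.2 x⟩ }
end

section
/- A compact Hausdorff space X is Corson compact (i.e., homeomorphic to a subset of the Σ-product Σ[0,1]^T = {x ∈ [0,1]^T : supp(x) countable} for some set T) if and only if X admits a full π-skeleton, i.e., there exist a set T, a topological embedding h : X → [0,1]^T and a pair generating a π-skeleton on h(X) whose induced space is all of h(X). -/
open Filter Topology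


/-- A family of sets `Φ B`, with sets of coordinates `Ψ B`, indexed by all subsets `B` of `Γ`:
each `Φ B` is the union of the `Φ C` over countable `C ⊆ B`, and for countable `C` it is compact
and meets every fibre of the projection of `X` to the coordinates in `Ψ C` in exactly one point. -/
structure IsProjectiveSystem {T Γ : Type*} (X : Set (T → unitInterval))
    (Φ : Set Γ → Set (T → unitInterval)) (Ψ : Set Γ → Set T) : Prop where
  mono : Monotone Φ
  coord_mono : Monotone Ψ
  subset : ∀ B, Φ B ⊆ X
  exists_countable : ∀ B, ∀ x ∈ Φ B, ∃ C ⊆ B, C.Countable ∧ x ∈ Φ C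
  exists_finite : ∀ B, ∀ i ∈ Ψ B, ∃ C ⊆ B, C.Finite ∧ i ∈ Ψ C
  coord_countable : ∀ C : Set Γ, C.Countable → (Ψ C).Countable
  isCompact : ∀ C : Set Γ, C.Countable → IsCompact (Φ C)
  eq_of_eqOn : ∀ C : Set Γ, C.Countable → ∀ x ∈ Φ C, ∀ y ∈ Φ C, Set.EqOn x y (Ψ C) → x = y
  exists_eqOn : ∀ C : Set Γ, C.Countable → ∀ x ∈ X, ∃ y ∈ Φ C, Set.EqOn y x (Ψ C)
  full : X ⊆ Φ Set.univ

section Product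

variable {T : Type*}

theorem exists_eqOn_iUnion_of_mem_closure {ι : Type*} [Nonempty ι]
    {K : Set (T → unitInterval)} (hK : IsCompact K) {A : ι → Set T} (hA : Directed (· ⊆ ·) A)
    {x : T → unitInterval}
    (hx : ∀ i, (A i).domRestrict x ∈ closure ((fun y => (A i).domRestrict y) '' K)) :
    ∃ y ∈ K, Set.EqOn y x (⋃ i, A i) := by
  have hclosed : ∀ i, IsClosed {y : T → unitInterval | Set.EqOn y x (A i)} := fun i => by
    have : {y : T → unitInterval | Set.EqOn y x (A i)} = ⋂ t ∈ A i, {y | y t = x t} := by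
      ext y; simp [Set.EqOn]
    rw [this]
    exact isClosed_biInter fun t _ => isClosed_eq (continuous_apply t) continuous_const
  obtain ⟨y, hy⟩ := IsCompact.nonempty_iInter_of_directed_nonempty_isCompact_isClosed
    (fun i => K ∩ {y | Set.EqOn y x (A i)})
    (fun i j => by
      obtain ⟨k, hi, hj⟩ := hA i j
      exact ⟨k, fun y hy => ⟨hy.1, hy.2.mono hi⟩, fun y hy => ⟨hy.1, hy.2.mono hj⟩⟩)
    (fun i => by
      have h := hx i
      rw [(hK.image (Pi.continuous_domRestrict (A i))).isClosed.closure_eq] at h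
      obtain ⟨y, hy, hyx⟩ := h
      exact ⟨y, hy, Set.domRestrict_eq_domRestrict_iff.1 hyx⟩)
    (fun i => hK.inter_right (hclosed i)) (fun i => hK.isClosed.inter (hclosed i))
  rw [Set.mem_iInter] at hy
  refine ⟨y, (hy (Classical.arbitrary ι)).1, fun t ht => ?_⟩
  obtain ⟨i, hi⟩ := Set.mem_iUnion.1 ht
  exact (hy i).2 hi

theorem exists_countable_subset_closure_image {A : Set T} (hA : A.Countable)
    (Y : Set (T → unitInterval)) :
    ∃ D ⊆ Y, D.Countable ∧
      (fun y => A.domRestrict y) '' Y ⊆ closure ((fun y => A.domRestrict y) '' D) := by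
  have := hA.to_subtype
  obtain ⟨E, hE, hEc, hYE⟩ := (TopologicalSpace.IsSeparable.of_separableSpace
    ((fun y : T → unitInterval => A.domRestrict y) '' Y)).exists_countable_dense_subset
  obtain ⟨D, hD, hinj, hDE⟩ := Set.SurjOn.exists_subset_injOn_image_eq (s := Y) (t := E)
    (f := fun y => A.domRestrict y) hE
  exact ⟨D, hD, Set.countable_of_injective_of_countable_image hinj (hDE ▸ hEc), hDE ▸ hYE⟩

end Product

namespace IsProjectiveSystem

variable {T Γ : Type*} {X : Set (T → unitInterval)}
  {Φ : Set Γ → Set (T → unitInterval)} {Ψ : Set Γ → Set T}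

theorem injOn_coord (S : IsProjectiveSystem X Φ Ψ) {B : Set Γ} {x y : T → unitInterval}
    (hx : x ∈ Φ B) (hy : y ∈ Φ B) (h : Set.EqOn x y (Ψ B)) : x = y := by
  obtain ⟨C, hCB, hC, hxC⟩ := S.exists_countable B x hx
  obtain ⟨D, hDB, hD, hyD⟩ := S.exists_countable B y hy
  exact S.eq_of_eqOn (C ∪ D) (hC.union hD) x (S.mono Set.subset_union_left hxC) y
    (S.mono Set.subset_union_right hyD) (h.mono (S.coord_mono (Set.union_subset hCB hDB)))

theorem coord_iUnion_nat (S : IsProjectiveSystem X Φ Ψ) {E : ℕ → Set Γ} (hE : Monotone E) :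
    Ψ (⋃ n, E n) ⊆ ⋃ n, Ψ (E n) := by
  intro i hi
  obtain ⟨C, hCE, hC, hiC⟩ := S.exists_finite _ i hi
  obtain ⟨n, hn⟩ := hE.directed_le.exists_mem_subset_of_finset_subset_biUnion
    (s := hC.toFinset) (by simpa using hCE)
  exact Set.mem_iUnion.2 ⟨n, S.coord_mono (by simpa using hn) hiC⟩

theorem exists_countable_superset (S : IsProjectiveSystem X Φ Ψ) (B : Set Γ) {E : Set Γ}
    (hE : E.Countable) : ∃ E', E ⊆ E' ∧ E'.Countable ∧
      (fun y => (Ψ E).domRestrict y) '' Φ B ⊆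
        closure ((fun y => (Ψ E).domRestrict y) '' Φ (E' ∩ B)) := by
  obtain ⟨D, hD, hDc, hcl⟩ := exists_countable_subset_closure_image (S.coord_countable E hE) (Φ B)
  choose! C hCB hC hmem using S.exists_countable B
  refine ⟨E ∪ ⋃ d ∈ D, C d, Set.subset_union_left,
    hE.union (hDc.biUnion fun d hd => hC d (hD hd)),
    hcl.trans (closure_mono (Set.image_mono fun d hd => ?_))⟩
  have hsub : C d ⊆ (E ∪ ⋃ d ∈ D, C d) ∩ B := fun c hc =>
    ⟨Or.inr (Set.mem_biUnion hd hc), hCB d (hD hd) hc⟩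
  exact S.mono hsub (hmem d (hD hd))

theorem isClosed (S : IsProjectiveSystem X Φ Ψ) (hX : IsClosed X) (B : Set Γ) :
    IsClosed (Φ B) := by
  refine isClosed_of_closure_subset fun x hx => ?_
  have hxX : x ∈ X := closure_minimal (S.subset B) hX hx
  obtain ⟨E₀, -, hE₀, hxE⟩ := S.exists_countable _ x (S.full hxX)
  choose! next hsub hcount hcl using fun E : Set Γ => S.exists_countable_superset B (E := E)
  let E : ℕ → Set Γ := fun n => next^[n] E₀
  have hEs : ∀ n, E (n + 1) = next (E n) := fun n => Function.iterate_succ_apply' _ _ _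
  have hE : ∀ n, (E n).Countable := fun n => by
    induction n with
    | zero => exact hE₀
    | succ n ih => rw [hEs]; exact hcount _ ih
  have hmono : Monotone E := monotone_nat_of_le_succ fun n => by
    rw [hEs]; exact hsub _ (hE n)
  have hEω : (⋃ n, E n).Countable := Set.countable_iUnion hE
  obtain ⟨y, hy, hyx⟩ := exists_eqOn_iUnion_of_mem_closure (A := fun n => Ψ (E n)) (x := x)
    (S.isCompact ((⋃ n, E n) ∩ B) (hEω.mono Set.inter_subset_left))
    (S.coord_mono.comp hmono).directed_le (fun n => by
      have h1 : (Ψ (E n)).domRestrict x ∈ closure ((fun y => (Ψ (E n)).domRestrict y) '' Φ B) :=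
        image_closure_subset_closure_image (Pi.continuous_domRestrict _) ⟨x, hx, rfl⟩
      refine closure_minimal (hcl _ (hE n)) isClosed_closure h1 |> closure_mono ?_
      refine Set.image_mono (S.mono (Set.inter_subset_inter_left B ?_))
      rw [← hEs]
      exact Set.subset_iUnion E (n + 1))
  have : y = x := S.eq_of_eqOn _ hEω y (S.mono Set.inter_subset_left hy) x
    (S.mono (Set.subset_iUnion E 0) hxE) (hyx.mono (S.coord_iUnion_nat hmono))
  exact this ▸ S.mono Set.inter_subset_right hy

theorem exists_mem_eqOn (S : IsProjectiveSystem X Φ Ψ) (hX : IsCompact X) (B : Set Γ)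
    {x : T → unitInterval} (hx : x ∈ X) : ∃ y ∈ Φ B, Set.EqOn y x (Ψ B) := by
  have : Nonempty {C : Set Γ // C.Finite ∧ C ⊆ B} := ⟨⟨∅, Set.finite_empty, B.empty_subset⟩⟩
  obtain ⟨y, hy, hyx⟩ := exists_eqOn_iUnion_of_mem_closure
    (ι := {C : Set Γ // C.Finite ∧ C ⊆ B}) (A := fun C => Ψ C) (x := x)
    (hX.of_isClosed_subset (S.isClosed hX.isClosed B) (S.subset B))
    (fun C D => ⟨⟨C ∪ D, C.2.1.union D.2.1, Set.union_subset C.2.2 D.2.2⟩,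
      S.coord_mono Set.subset_union_left, S.coord_mono Set.subset_union_right⟩)
    (fun C => by
      obtain ⟨y, hy, hyx⟩ := S.exists_eqOn C C.2.1.countable x hx
      exact subset_closure ⟨y, S.mono C.2.2 hy, Set.domRestrict_eq_domRestrict_iff.2 hyx⟩)
  refine ⟨y, hy, hyx.mono fun i hi => ?_⟩
  obtain ⟨C, hCB, hC, hiC⟩ := S.exists_finite B i hi
  exact Set.mem_iUnion.2 ⟨⟨C, hC, hCB⟩, hiC⟩

theorem exists_retraction (S : IsProjectiveSystem X Φ Ψ) (hX : IsCompact X) (B : Set Γ) :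
    ∃ r : X → X, Continuous r ∧ (∀ x, (r x : T → unitInterval) ∈ Φ B) ∧
      ∀ x, Set.EqOn (r x : T → unitInterval) x (Ψ B) := by
  choose r hr hrx using fun x : X => S.exists_mem_eqOn hX B x.2
  refine ⟨fun x => ⟨r x, S.subset B (hr x)⟩, ?_, hr, hrx⟩
  have : CompactSpace (Φ B) := isCompact_iff_compactSpace.1
    (hX.of_isClosed_subset (S.isClosed hX.isClosed B) (S.subset B))
  have hemb : Topology.IsClosedEmbedding (fun y : Φ B => (Ψ B).domRestrict y.1) :=
    ((Pi.continuous_domRestrict _).comp continuous_subtype_val).isClosedEmbedding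
      fun y z h => Subtype.ext
        (S.injOn_coord y.2 z.2 (Set.domRestrict_eq_domRestrict_iff.1 h))
  have hcont : Continuous fun x : X => (⟨r x, hr x⟩ : Φ B) := by
    rw [hemb.isInducing.continuous_iff]
    convert (Pi.continuous_domRestrict (Ψ B)).comp
      (continuous_subtype_val : Continuous (Subtype.val : X → _)) using 1
    exact funext fun x => Set.domRestrict_eq_domRestrict_iff.2 (hrx x)
  exact (continuous_subtype_val.comp hcont).subtype_mk _

/-- The retraction of `X` onto `Φ B` along the fibres of the projection to `Ψ B`. -/
noncomputable def retraction (S : IsProjectiveSystem X Φ Ψ) (hX : IsCompact X) (B : Set Γ) :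
    X → X :=
  (S.exists_retraction hX B).choose

theorem continuous_retraction (S : IsProjectiveSystem X Φ Ψ) (hX : IsCompact X) (B : Set Γ) :
    Continuous (S.retraction hX B) :=
  (S.exists_retraction hX B).choose_spec.1

theorem retraction_mem (S : IsProjectiveSystem X Φ Ψ) (hX : IsCompact X) (B : Set Γ) (x : X) :
    (S.retraction hX B x : T → unitInterval) ∈ Φ B :=
  (S.exists_retraction hX B).choose_spec.2.1 x

theorem retraction_eqOn (S : IsProjectiveSystem X Φ Ψ) (hX : IsCompact X) (B : Set Γ) (x : X) :
    Set.EqOn (S.retraction hX B x : T → unitInterval) x (Ψ B) :=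
  (S.exists_retraction hX B).choose_spec.2.2 x

theorem retraction_eq (S : IsProjectiveSystem X Φ Ψ) (hX : IsCompact X) {B : Set Γ} {x z : X}
    (hz : (z : T → unitInterval) ∈ Φ B) (hzx : Set.EqOn (z : T → unitInterval) x (Ψ B)) :
    S.retraction hX B x = z :=
  Subtype.ext (S.injOn_coord (S.retraction_mem hX B x) hz
    ((S.retraction_eqOn hX B x).trans hzx.symm))

theorem retraction_eq_iff (S : IsProjectiveSystem X Φ Ψ) (hX : IsCompact X) {B : Set Γ}
    {x y : X} : S.retraction hX B x = S.retraction hX B y ↔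
      Set.EqOn (x : T → unitInterval) y (Ψ B) := by
  refine ⟨fun h => ?_, fun h => S.retraction_eq hX (S.retraction_mem hX B y)
    ((S.retraction_eqOn hX B y).trans h.symm)⟩
  have h1 := S.retraction_eqOn hX B x
  rw [h] at h1
  exact h1.symm.trans (S.retraction_eqOn hX B y)

section WellOrder

variable {ι : Type*} [LinearOrder ι]

theorem countable_jumps_of_isLowerSet (S : IsProjectiveSystem X Φ Ψ) (hX : IsCompact X)
    (b : ι → Γ) (x : X) {L : Set ι} (hL : IsLowerSet L)
    (h : ∀ c ∈ L, ({i | S.retraction hX (b '' Set.Iic i) x ≠ S.retraction hX (b '' Set.Iio i) x} ∩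
      Set.Iio c).Countable) :
    ({i | S.retraction hX (b '' Set.Iic i) x ≠ S.retraction hX (b '' Set.Iio i) x} ∩
      L).Countable := by
  set J := {i | S.retraction hX (b '' Set.Iic i) x ≠ S.retraction hX (b '' Set.Iio i) x}
  obtain ⟨C, hC, hCc, hmem⟩ := S.exists_countable _ _ (S.retraction_mem hX (b '' L) x)
  obtain ⟨C', hC'L, hinj, rfl⟩ := Set.SurjOn.exists_subset_injOn_image_eq (s := L) (t := C) hC
  have hC' : C'.Countable := Set.countable_of_injective_of_countable_image hinj hCc
  by_cases hb : ∃ c ∈ L, ∀ c' ∈ C', c' ≤ c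
  · obtain ⟨c, hcL, hc⟩ := hb
    refine ((h c hcL).insert c).mono fun i hi => ?_
    rcases lt_trichotomy i c with hic | rfl | hci
    · exact Or.inr ⟨hi.1, hic⟩
    · exact Or.inl rfl
    · have hIio : (S.retraction hX (b '' L) x : T → unitInterval) ∈ Φ (b '' Set.Iio i) :=
        S.mono (Set.image_mono fun c' hc' => (hc c' hc').trans_lt hci) hmem
      have hsub : Set.Iic i ⊆ L := fun j hj => hL hj hi.2
      have heq := S.retraction_eqOn hX (b '' L) x
      refine absurd ?_ hi.1
      rw [S.retraction_eq hX hIio (heq.mono (S.coord_mono (Set.image_mono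
          (Set.Iio_subset_Iic_self.trans hsub)))),
        S.retraction_eq hX (S.mono (Set.image_mono Set.Iio_subset_Iic_self) hIio)
          (heq.mono (S.coord_mono (Set.image_mono hsub)))]
  · push Not at hb
    refine (hC'.biUnion fun c' hc' => h c' (hC'L hc')).mono fun i hi => ?_
    obtain ⟨c', hc', hlt⟩ := hb i hi.2
    exact Set.mem_biUnion hc' ⟨hi.1, hlt⟩

theorem countable_jumps [WellFoundedLT ι] (S : IsProjectiveSystem X Φ Ψ) (hX : IsCompact X)
    (b : ι → Γ) (x : X) :
    {i | S.retraction hX (b '' Set.Iic i) x ≠ S.retraction hX (b '' Set.Iio i) x}.Countable := by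
  have h : ∀ c, ({i | S.retraction hX (b '' Set.Iic i) x ≠ S.retraction hX (b '' Set.Iio i) x} ∩
      Set.Iio c).Countable := fun c => by
    induction c using WellFoundedLT.induction with
    | ind c ih => exact S.countable_jumps_of_isLowerSet hX b x (isLowerSet_Iio c) ih
  simpa using S.countable_jumps_of_isLowerSet hX b x isLowerSet_univ fun c _ => h c

theorem eqOn_coord_image (S : IsProjectiveSystem X Φ Ψ) (b : ι → Γ) {x y : T → unitInterval}
    {L : Set ι} (h₀ : Set.EqOn x y (Ψ ∅)) (h : ∀ c ∈ L, Set.EqOn x y (Ψ (b '' Set.Iic c))) :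
    Set.EqOn x y (Ψ (b '' L)) := by
  intro t ht
  obtain ⟨C, hC, hCf, htC⟩ := S.exists_finite _ t ht
  obtain ⟨C', hC'L, hinj, rfl⟩ := Set.SurjOn.exists_subset_injOn_image_eq (s := L) (t := C) hC
  have hC' : C'.Finite := hCf.of_finite_image hinj
  rcases C'.eq_empty_or_nonempty with rfl | hne
  · exact h₀ (by simpa using htC)
  · obtain ⟨c, hc, hmax⟩ := hC'.exists_maximalFor id C' hne
    refine h c (hC'L hc) (S.coord_mono (Set.image_mono fun j hj => ?_) htC)
    exact (le_total j c).elim id fun hcj => hmax hj hcj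

end WellOrder

/-- A point-countable family of continuous functions on `X` which determines the coordinates
in `Ψ B`. -/
structure IsSeparatingFamily (X : Set (T → unitInterval)) (A : Set T) (𝓕 : Set (X → ℝ)) :
    Prop where
  continuous : ∀ f ∈ 𝓕, Continuous f
  countable : ∀ x, {f ∈ 𝓕 | f x ≠ 0}.Countable
  eqOn : ∀ x y : X, (∀ f ∈ 𝓕, f x = f y) → Set.EqOn (x : T → unitInterval) y A

theorem isSeparatingFamily_coordinates (X : Set (T → unitInterval)) {A : Set T}
    (hA : A.Countable) :
    IsSeparatingFamily X A ((fun t (x : X) => (x.1 t : ℝ)) '' A) where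
  continuous := by
    rintro _ ⟨t, -, rfl⟩
    exact continuous_subtype_val.comp ((continuous_apply t).comp continuous_subtype_val)
  countable x := (hA.image _).mono fun f hf => hf.1
  eqOn x y h t ht := Subtype.ext (h _ ⟨t, ht, rfl⟩)

theorem exists_isSeparatingFamily_range {ι : Type*} [LinearOrder ι] [WellFoundedLT ι]
    (S : IsProjectiveSystem X Φ Ψ) (hX : IsCompact X) (b : ι → Γ)
    (h : ∀ i, ∃ 𝓖, IsSeparatingFamily X (Ψ (b '' Set.Iic i)) 𝓖) :
    ∃ 𝓕, IsSeparatingFamily X (Ψ (Set.range b)) 𝓕 := by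
  choose 𝓖 h𝓖 using h
  have h₀ := isSeparatingFamily_coordinates X (S.coord_countable ∅ Set.countable_empty)
  set 𝓕₀ := (fun t (x : X) => (x.1 t : ℝ)) '' Ψ ∅
  let J : ι → X → X := fun i => S.retraction hX (b '' Set.Iic i)
  let I : ι → X → X := fun i => S.retraction hX (b '' Set.Iio i)
  let δ : ι → (X → ℝ) → X → ℝ := fun i g x => g (J i x) - g (I i x)
  refine ⟨𝓕₀ ∪ ⋃ i, δ i '' 𝓖 i, ?_, fun x => ?_, fun x y hxy => ?_⟩
  · rintro f (hf | hf)
    · exact h₀.continuous f hf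
    · obtain ⟨i, g, hg, rfl⟩ := Set.mem_iUnion.1 hf
      have hgc := (h𝓖 i).continuous g hg
      exact (hgc.comp (S.continuous_retraction hX _)).sub
        (hgc.comp (S.continuous_retraction hX _))
  · have hc := (S.countable_jumps hX b x).biUnion fun i _ =>
      (((h𝓖 i).countable (J i x)).union ((h𝓖 i).countable (I i x))).image (δ i)
    refine ((h₀.countable x).union hc).mono ?_
    rintro f ⟨hf | hf, hfx⟩
    · exact Or.inl ⟨hf, hfx⟩
    · obtain ⟨i, g, hg, rfl⟩ := Set.mem_iUnion.1 hf
      have hne : J i x ≠ I i x := fun hJI => hfx (by simp [δ, hJI])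
      refine Or.inr (Set.mem_biUnion hne ⟨g, ?_, rfl⟩)
      by_cases hgJ : g (J i x) = 0
      · refine Or.inr ⟨hg, fun hgI => hfx ?_⟩
        simp [δ, hgJ, hgI]
      · exact Or.inl ⟨hg, hgJ⟩
  · have hbase : Set.EqOn (x : T → unitInterval) y (Ψ ∅) :=
      h₀.eqOn x y fun f hf => hxy f (Or.inl hf)
    have hIic : ∀ i, Set.EqOn (x : T → unitInterval) y (Ψ (b '' Set.Iic i)) := fun i => by
      induction i using WellFoundedLT.induction with
      | ind i ih =>
        have hI : I i x = I i y := (S.retraction_eq_iff hX).2 (S.eqOn_coord_image b hbase ih)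
        have hJ := (h𝓖 i).eqOn (J i x) (J i y) fun g hg => by
          have := hxy (δ i g) (Or.inr (Set.mem_iUnion.2 ⟨i, g, hg, rfl⟩))
          simpa [δ, hI] using this
        exact ((S.retraction_eqOn hX _ x).symm.trans hJ).trans (S.retraction_eqOn hX _ y)
    rw [← Set.image_univ]
    exact S.eqOn_coord_image b hbase fun i _ => hIic i

theorem exists_isSeparatingFamily (S : IsProjectiveSystem X Φ Ψ) (hX : IsCompact X)
    (B : Set Γ) : ∃ 𝓕, IsSeparatingFamily X (Ψ B) 𝓕 := by
  induction B using (InvImage.wf (fun B : Set Γ => Cardinal.mk B) Cardinal.lt_wf).induction with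
  | _ B ih =>
    by_cases hB : B.Countable
    · exact ⟨_, isSeparatingFamily_coordinates X (S.coord_countable B hB)⟩
    have hinf : Cardinal.aleph0 ≤ Cardinal.mk B := by
      rw [← Cardinal.le_aleph0_iff_set_countable, not_le] at hB
      exact hB.le
    obtain ⟨e⟩ : Nonempty ((Cardinal.mk B).ord.ToType ≃ B) :=
      Cardinal.eq.1 (Cardinal.mk_ord_toType _)
    have hrange : Set.range (fun i => (e i : Γ)) = B := by
      rw [← Function.comp_def, e.surjective.range_comp, Subtype.range_coe]
    rw [← hrange]
    refine S.exists_isSeparatingFamily_range hX _ fun i => ih _ ?_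
    refine Cardinal.mk_image_le.trans_lt ?_
    rw [← Set.Iio_insert]
    exact Cardinal.mk_insert_le.trans_lt (Cardinal.add_lt_of_lt hinf
      ((Cardinal.mk_Iio_lt i (by simp)).trans_eq (Cardinal.mk_ord_toType _))
      (Cardinal.one_lt_aleph0.trans_le hinf))

end IsProjectiveSystem

/-- The map `u ↦ u⁺ / (1 + u⁺)` from the real line to the unit interval. -/
noncomputable def squashPos (u : ℝ) : unitInterval :=
  ⟨max u 0 / (1 + max u 0), by positivity, by
    rw [div_le_one (by positivity)]; linarith⟩

theorem continuous_squashPos : Continuous squashPos := by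
  refine Continuous.subtype_mk (Continuous.div (by fun_prop) (by fun_prop) fun u => ?_) _
  positivity

theorem squashPos_zero : squashPos 0 = 0 := by
  ext; simp [squashPos]

theorem eq_of_squashPos_eq {u v : ℝ} (h : squashPos u = squashPos v)
    (h' : squashPos (-u) = squashPos (-v)) : u = v := by
  have key : ∀ {a b : ℝ}, squashPos a = squashPos b → max a 0 = max b 0 := fun {a b} hab => by
    have h1 : max a 0 / (1 + max a 0) = max b 0 / (1 + max b 0) := congrArg Subtype.val hab
    rw [div_eq_div_iff (by positivity) (by positivity)] at h1
    linarith
  have h1 := key h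
  have h2 := key h'
  rw [← max_zero_sub_max_neg_zero_eq_self u, ← max_zero_sub_max_neg_zero_eq_self v, h1, h2]

theorem exists_isEmbedding_countable_support {X : Type u} [TopologicalSpace X] [CompactSpace X]
    (𝓕 : Set (X → ℝ)) (hcont : ∀ f ∈ 𝓕, Continuous f)
    (hcount : ∀ x, {f ∈ 𝓕 | f x ≠ 0}.Countable)
    (hsep : ∀ x y, (∀ f ∈ 𝓕, f x = f y) → x = y) :
    ∃ (T : Type u) (h : X → T → unitInterval), Topology.IsEmbedding h ∧
      ∀ x : X, ({t : T | h x t ≠ 0}).Countable := by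
  let h : X → 𝓕 × Bool → unitInterval := fun x p => squashPos (cond p.2 (p.1.1 x) (-p.1.1 x))
  have hh : Continuous h := continuous_pi fun p => by
    refine continuous_squashPos.comp ?_
    have := hcont p.1 p.1.2
    rcases p with ⟨f, _ | _⟩
    · exact this.neg
    · exact this
  refine ⟨𝓕 × Bool, h, (hh.isClosedEmbedding fun x y hxy => hsep x y fun f hf =>
    eq_of_squashPos_eq (congrFun hxy (⟨f, hf⟩, true))
      (congrFun hxy (⟨f, hf⟩, false))).isEmbedding, fun x => ?_⟩
  refine (((hcount x).preimage Subtype.val_injective).prod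
    (Set.countable_univ (α := Bool))).mono ?_
  rintro ⟨f, c⟩ hfc
  refine ⟨⟨f.2, fun h0 => hfc ?_⟩, trivial⟩
  replace h0 : f.1 x = 0 := h0
  cases c <;> simp [h, h0, squashPos_zero]

theorem exists_monotone_finset_upperBound {Γ : Type*} [Preorder Γ] [IsDirectedOrder Γ]
    [Nonempty Γ] : ∃ σ : Finset Γ → Γ, Monotone σ ∧ ∀ s, ∀ b ∈ s, b ≤ σ s := by
  classical
  have hbdd : ∀ (s : Finset Γ) (ih : ∀ t ⊂ s, Γ),
      BddAbove ((s : Set Γ) ∪ Set.range fun t : s.ssubsets => ih t (Finset.mem_ssubsets.1 t.2)) :=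
    fun s ih => (s.finite_toSet.union (Set.finite_range _)).bddAbove
  let H : ∀ s : Finset Γ, (∀ t ⊂ s, Γ) → Γ := fun s ih => (hbdd s ih).choose
  have hσ : ∀ s : Finset Γ, Finset.strongInduction H s ∈ upperBounds ((s : Set Γ) ∪ Set.range
      fun t : s.ssubsets => Finset.strongInduction H t.1) := fun s => by
    rw [Finset.strongInduction_eq]
    exact (hbdd s fun t _ => Finset.strongInduction H t).choose_spec
  refine ⟨Finset.strongInduction H, fun s t hst => ?_, fun s b hb => hσ s (Or.inl hb)⟩
  rcases hst.eq_or_ssubset with rfl | hlt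
  · exact le_rfl
  · exact hσ t (Or.inr ⟨⟨s, Finset.mem_ssubsets.2 hlt⟩, rfl⟩)

theorem Directed.exists_seq_cofinal {α Γ : Type*} [Countable α] [Nonempty α] [Preorder Γ]
    {f : α → Γ} (hf : Directed (· ≤ ·) f) :
    ∃ a : ℕ → α, Monotone (f ∘ a) ∧ ∀ i, ∃ n, f i ≤ f (a n) := by
  have := Encodable.ofCountable α
  inhabit α
  exact ⟨hf.sequence f, hf.sequence_mono, fun i => ⟨_, hf.le_sequence i⟩⟩

namespace IsPiSkeleton

variable {T Γ : Type*} [PartialOrder Γ] {X : Set (T → unitInterval)}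
  {F : Γ → Set (T → unitInterval)} {ψ : Γ → Set T}

theorem isCompact (h : IsPiSkeleton X F ψ) (hX : IsCompact X) (s : Γ) : IsCompact (F s) := by
  have hrange : Set.range (fun x : F s => (ψ s).domRestrict x.1) =
      (fun x => (ψ s).domRestrict x) '' F s := by
    ext z; simp
  rw [isCompact_iff_isCompact_univ, (h.embeds s).isCompact_iff, Set.image_univ]
  exact (hrange.trans (h.image_eq s).symm) ▸ hX.image (Pi.continuous_domRestrict (ψ s))

theorem exists_isLUB (h : IsPiSkeleton X F ψ) {α : Type*} [Countable α] [Nonempty α]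
    {f : α → Γ} (hf : Directed (· ≤ ·) f) :
    ∃ u, IsLUB (Set.range f) u ∧ ψ u = ⋃ a, ψ (f a) := by
  obtain ⟨a, ha, hcof⟩ := hf.exists_seq_cofinal
  obtain ⟨u, hu⟩ := h.sigma_complete _ ha
  have hu' : IsLUB (Set.range f) u := by
    refine ⟨?_, fun v hv => hu.2 ?_⟩
    · rintro _ ⟨i, rfl⟩
      obtain ⟨n, hn⟩ := hcof i
      exact hn.trans (hu.1 ⟨n, rfl⟩)
    · rintro _ ⟨n, rfl⟩
      exact hv ⟨a n, rfl⟩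
  refine ⟨u, hu', subset_antisymm ?_ (Set.iUnion_subset fun i => h.psi_mono (hu'.1 ⟨i, rfl⟩))⟩
  rw [h.psi_omega _ ha u hu]
  exact Set.iUnion_subset fun n => Set.subset_iUnion (fun i => ψ (f i)) (a n)

theorem exists_isProjectiveSystem [Nonempty Γ] (h : IsPiSkeleton X F ψ) (hX : IsCompact X)
    (hfull : (⋃ s, F s) = X) :
    ∃ (Φ : Set Γ → Set (T → unitInterval)) (Ψ : Set Γ → Set T), IsProjectiveSystem X Φ Ψ := by
  have : IsDirectedOrder Γ := ⟨h.directed⟩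
  obtain ⟨σ, hσ, hσmem⟩ := exists_monotone_finset_upperBound (Γ := Γ)
  let fin : Set Γ → Type _ := fun B => {s : Finset Γ // (s : Set Γ) ⊆ B}
  have hne : ∀ B, Nonempty (fin B) := fun B => ⟨⟨∅, by simp⟩⟩
  have hct : ∀ C : Set Γ, C.Countable → Countable (fin C) := fun C hC => by
    have := hC.to_subtype
    classical
    refine (show Function.Surjective fun s : Finset C =>
      (⟨s.map (Function.Embedding.subtype _), by simp⟩ : fin C) from fun s => ?_).countable
    exact ⟨s.1.subtype (· ∈ C), Subtype.ext (Finset.subtype_map_of_mem fun x hx => s.2 hx)⟩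
  have hdir : ∀ C, Directed (· ≤ ·) fun s : fin C => σ s.1 := fun C s t => by
    classical
    exact ⟨⟨s.1 ∪ t.1, by simpa using ⟨s.2, t.2⟩⟩, hσ Finset.subset_union_left,
      hσ Finset.subset_union_right⟩
  have hlub : ∀ C : Set Γ, C.Countable → ∃ u,
      IsLUB (Set.range fun s : fin C => σ s.1) u ∧ ψ u = ⋃ s : fin C, ψ (σ s.1) := fun C hC =>
    have := hct C hC
    h.exists_isLUB (hdir C)
  choose! τ hτ hψτ using hlub
  let Ψ : Set Γ → Set T := fun B => ⋃ s : fin B, ψ (σ s.1)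
  let Φ : Set Γ → Set (T → unitInterval) := fun B =>
    ⋃ C : {C : Set Γ // C.Countable ∧ C ⊆ B}, F (τ C)
  have hτmono : ∀ C D : Set Γ, C.Countable → D.Countable → C ⊆ D → τ C ≤ τ D :=
    fun C D hC hD hCD => (hτ C hC).2 (by
      rintro _ ⟨s, rfl⟩
      exact (hτ D hD).1 ⟨⟨s.1, s.2.trans hCD⟩, rfl⟩)
  have hΦ : ∀ C : Set Γ, C.Countable → Φ C = F (τ C) := fun C hC =>
    subset_antisymm (Set.iUnion_subset fun D => h.mono (hτmono D C D.2.1 hC D.2.2))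
      (Set.subset_iUnion (fun D : {D : Set Γ // D.Countable ∧ D ⊆ C} => F (τ D))
        ⟨C, hC, subset_rfl⟩)
  have hΨ : Monotone Ψ := fun B D hBD => Set.iUnion_subset fun s =>
    Set.subset_iUnion (fun s : fin D => ψ (σ s.1)) ⟨s.1, s.2.trans hBD⟩
  have hΦmono : Monotone Φ := fun B D hBD => Set.iUnion_subset fun C =>
    Set.subset_iUnion (fun C : {C : Set Γ // C.Countable ∧ C ⊆ D} => F (τ C))
      ⟨C.1, C.2.1, C.2.2.trans hBD⟩
  refine ⟨Φ, Ψ, hΦmono, hΨ, fun B => Set.iUnion_subset fun C => h.subset_X _, ?_, ?_, ?_, ?_,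
    ?_, ?_, ?_⟩
  · intro B x hx
    obtain ⟨C, hxC⟩ := Set.mem_iUnion.1 hx
    exact ⟨C, C.2.2, C.2.1, by rwa [hΦ C C.2.1]⟩
  · intro B i hi
    obtain ⟨s, hs⟩ := Set.mem_iUnion.1 hi
    exact ⟨s.1, s.2, s.1.finite_toSet, Set.mem_iUnion.2 ⟨⟨s.1, subset_rfl⟩, hs⟩⟩
  · intro C hC
    have := hct C hC
    exact Set.countable_iUnion fun s => h.countable _
  · intro C hC
    rw [hΦ C hC]
    exact h.isCompact hX _
  · intro C hC x hx y hy hxy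
    rw [hΦ C hC] at hx hy
    refine congrArg Subtype.val ((h.embeds (τ C)).injective (a₁ := ⟨x, hx⟩) (a₂ := ⟨y, hy⟩) ?_)
    exact Set.domRestrict_eq_domRestrict_iff.2 ((hψτ C hC).symm ▸ hxy)
  · intro C hC x hx
    obtain ⟨y, hy, hyx⟩ := (h.image_eq (τ C)).subset ⟨x, hx, rfl⟩
    refine ⟨y, (hΦ C hC).symm ▸ hy, ?_⟩
    have := Set.domRestrict_eq_domRestrict_iff.1 hyx
    rwa [hψτ C hC] at this
  · intro x hx
    rw [← hfull] at hx
    obtain ⟨s, hs⟩ := Set.mem_iUnion.1 hx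
    have hsτ : s ≤ τ {s} := (hσmem {s} s (Finset.mem_singleton_self s)).trans
      ((hτ {s} (Set.countable_singleton s)).1 ⟨⟨{s}, by simp⟩, rfl⟩)
    exact Set.mem_iUnion.2 ⟨⟨{s}, Set.countable_singleton s, Set.subset_univ _⟩, h.mono hsτ hs⟩

theorem exists_pointCountable_separating (h : IsPiSkeleton X F ψ) (hX : IsCompact X)
    (hfull : (⋃ s, F s) = X) :
    ∃ 𝓕 : Set (X → ℝ), (∀ f ∈ 𝓕, Continuous f) ∧ (∀ x, {f ∈ 𝓕 | f x ≠ 0}.Countable) ∧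
      ∀ x y, (∀ f ∈ 𝓕, f x = f y) → x = y := by
  rcases isEmpty_or_nonempty Γ with hΓ | hΓ
  · rw [Set.iUnion_of_empty] at hfull
    subst hfull
    exact ⟨∅, by simp, by simp, fun x => x.2.elim⟩
  obtain ⟨Φ, Ψ, S⟩ := h.exists_isProjectiveSystem hX hfull
  obtain ⟨𝓕, h𝓕⟩ := S.exists_isSeparatingFamily hX Set.univ
  exact ⟨𝓕, h𝓕.continuous, h𝓕.countable, fun x y hxy =>
    Subtype.ext (S.injOn_coord (S.full x.2) (S.full y.2) (h𝓕.eqOn x y hxy))⟩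

end IsPiSkeleton

section Corson

variable {T : Type*}

/-- The points of `X` supported in `A`. -/
def pointsSupportedIn (X : Set (T → unitInterval)) (A : Set T) : Set (T → unitInterval) :=
  {x ∈ X | Function.support x ⊆ A}

/-- Every point of `X` agrees on `A` with a point of `X` supported in `A`. -/
def IsGoodCoordinateSet (X : Set (T → unitInterval)) (A : Set T) : Prop :=
  ∀ x ∈ X, ∃ y ∈ pointsSupportedIn X A, Set.EqOn y x A

theorem pointsSupportedIn_mono (X : Set (T → unitInterval)) : Monotone (pointsSupportedIn X) :=
  fun _ _ hAB _ hx => ⟨hx.1, hx.2.trans hAB⟩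

theorem isCompact_pointsSupportedIn {X : Set (T → unitInterval)} (hX : IsCompact X)
    (A : Set T) : IsCompact (pointsSupportedIn X A) := by
  have : pointsSupportedIn X A = X ∩ ⋂ t ∈ Aᶜ, {x | x t = 0} := by
    ext x
    simp only [pointsSupportedIn, Function.support_subset_iff', Set.mem_inter_iff,
      Set.mem_iInter, Set.mem_compl_iff]
    rfl
  rw [this]
  exact hX.inter_right
    (isClosed_biInter fun t _ => isClosed_eq (continuous_apply t) continuous_const)

theorem eq_of_eqOn_of_mem_pointsSupportedIn {X : Set (T → unitInterval)} {A : Set T}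
    {x y : T → unitInterval} (hx : x ∈ pointsSupportedIn X A) (hy : y ∈ pointsSupportedIn X A)
    (h : Set.EqOn x y A) : x = y := by
  funext t
  by_cases ht : t ∈ A
  · exact h ht
  · rw [Function.support_subset_iff'.1 hx.2 t ht, Function.support_subset_iff'.1 hy.2 t ht]

theorem isGoodCoordinateSet_iUnion {X : Set (T → unitInterval)} (hX : IsCompact X)
    {A : ℕ → Set T} (hA : Monotone A) (h : ∀ n, IsGoodCoordinateSet X (A n)) :
    IsGoodCoordinateSet X (⋃ n, A n) := fun x hx =>
  exists_eqOn_iUnion_of_mem_closure (isCompact_pointsSupportedIn hX _) hA.directed_le fun n => by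
    obtain ⟨y, hy, hyx⟩ := h n x hx
    exact subset_closure ⟨y, pointsSupportedIn_mono X (Set.subset_iUnion A n) hy,
      Set.domRestrict_eq_domRestrict_iff.2 hyx⟩

theorem exists_isGoodCoordinateSet_superset {X : Set (T → unitInterval)} (hX : IsCompact X)
    (hsupp : ∀ x ∈ X, (Function.support x).Countable) {A₀ : Set T} (hA₀ : A₀.Countable) :
    ∃ A, A₀ ⊆ A ∧ A.Countable ∧ IsGoodCoordinateSet X A := by
  have step : ∀ A : Set T, A.Countable → ∃ A', A ⊆ A' ∧ A'.Countable ∧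
      (fun y => A.domRestrict y) '' X ⊆
        closure ((fun y => A.domRestrict y) '' pointsSupportedIn X A') := fun A hA => by
    obtain ⟨D, hD, hDc, hcl⟩ := exists_countable_subset_closure_image hA X
    refine ⟨A ∪ ⋃ d ∈ D, Function.support d, Set.subset_union_left,
      hA.union (hDc.biUnion fun d hd => hsupp d (hD hd)),
      hcl.trans (closure_mono (Set.image_mono fun d hd => ⟨hD hd, ?_⟩))⟩
    exact (Set.subset_biUnion_of_mem (u := fun d => Function.support d) hd).trans
      Set.subset_union_right
  choose! next hsub hcount hcl using step
  let A : ℕ → Set T := fun n => next^[n] A₀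
  have hAs : ∀ n, A (n + 1) = next (A n) := fun n => Function.iterate_succ_apply' _ _ _
  have hA : ∀ n, (A n).Countable := fun n => by
    induction n with
    | zero => exact hA₀
    | succ n ih => rw [hAs]; exact hcount _ ih
  have hmono : Monotone A := monotone_nat_of_le_succ fun n => by
    rw [hAs]; exact hsub _ (hA n)
  refine ⟨⋃ n, A n, Set.subset_iUnion A 0, Set.countable_iUnion hA, fun x hx => ?_⟩
  refine exists_eqOn_iUnion_of_mem_closure (isCompact_pointsSupportedIn hX _) hmono.directed_le
    fun n => closure_mono (Set.image_mono (pointsSupportedIn_mono X ?_))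
      (hcl _ (hA n) ⟨x, hx, rfl⟩)
  rw [← hAs]
  exact Set.subset_iUnion A (n + 1)

theorem iUnion_pointsSupportedIn {X : Set (T → unitInterval)} (hX : IsCompact X)
    (hsupp : ∀ x ∈ X, (Function.support x).Countable) :
    ⋃ A : {A : Set T // A.Countable ∧ IsGoodCoordinateSet X A}, pointsSupportedIn X A = X := by
  refine subset_antisymm (Set.iUnion_subset fun A x hx => hx.1) fun x hx => ?_
  obtain ⟨A, hsub, hA⟩ := exists_isGoodCoordinateSet_superset hX hsupp (hsupp x hx)
  exact Set.mem_iUnion.2 ⟨⟨A, hA⟩, hx, hsub⟩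

theorem isPiSkeleton_pointsSupportedIn {X : Set (T → unitInterval)} (hX : IsCompact X)
    (hsupp : ∀ x ∈ X, (Function.support x).Countable) :
    IsPiSkeleton X
      (fun A : {A : Set T // A.Countable ∧ IsGoodCoordinateSet X A} => pointsSupportedIn X A)
      (fun A => A) := by
  have hlub : ∀ f : ℕ → {A : Set T // A.Countable ∧ IsGoodCoordinateSet X A}, Monotone f →
      ∃ u, IsLUB (Set.range f) u ∧ (u : Set T) = ⋃ n, (f n : Set T) := fun f hf =>
    ⟨⟨⋃ n, (f n : Set T), Set.countable_iUnion fun n => (f n).2.1,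
      isGoodCoordinateSet_iUnion hX (fun m n hmn => hf hmn) fun n => (f n).2.2⟩,
      ⟨by
        rintro _ ⟨n, rfl⟩
        exact Set.subset_iUnion (fun n => (f n : Set T)) n,
       fun v hv => Set.iUnion_subset fun n => hv ⟨n, rfl⟩⟩, rfl⟩
  have hemb : ∀ A : {A : Set T // A.Countable ∧ IsGoodCoordinateSet X A},
      Topology.IsEmbedding fun x : pointsSupportedIn X A => A.1.domRestrict x.1 := fun A =>
    have : CompactSpace (pointsSupportedIn X A.1) :=
      isCompact_iff_compactSpace.1 (isCompact_pointsSupportedIn hX A)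
    (((Pi.continuous_domRestrict A.1).comp continuous_subtype_val).isClosedEmbedding
      fun x y hxy => Subtype.ext (eq_of_eqOn_of_mem_pointsSupportedIn x.2 y.2
        (Set.domRestrict_eq_domRestrict_iff.1 hxy))).isEmbedding
  exact
  { directed := fun A B => by
      obtain ⟨C, hsub, hC⟩ := exists_isGoodCoordinateSet_superset hX hsupp (A.2.1.union B.2.1)
      exact ⟨⟨C, hC⟩, Set.subset_union_left.trans hsub, Set.subset_union_right.trans hsub⟩
    sigma_complete := fun f hf => (hlub f hf).imp fun _ => And.left
    subset_X := fun A x hx => hx.1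
    cosmic := fun A =>
      have := A.2.1.to_subtype
      (hemb A).secondCountableTopology
    mono := fun A B hAB => pointsSupportedIn_mono X hAB
    dense := by rw [iUnion_pointsSupportedIn hX hsupp]; exact subset_closure
    countable := fun A => A.2.1
    psi_mono := fun A B hAB => hAB
    psi_omega := fun f hf u hu => by
      obtain ⟨v, hv, hveq⟩ := hlub f hf
      rw [hu.unique hv, hveq]
    embeds := hemb
    image_eq := fun A => by
      refine subset_antisymm ?_ (Set.image_mono fun x hx => hx.1)
      rintro _ ⟨x, hx, rfl⟩
      obtain ⟨y, hy, hyx⟩ := A.2.2 x hx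
      exact ⟨y, hy, Set.domRestrict_eq_domRestrict_iff.2 hyx⟩ }

end Corson

/-- Corollary 5.10: a compact Hausdorff space is Corson compact iff it admits a
full π-skeleton. -/
theorem statement13 {X : Type u} [TopologicalSpace X] [CompactSpace X] [T2Space X] :
    (∃ (T : Type u) (h : X → T → unitInterval), Topology.IsEmbedding h ∧
        ∀ x : X, ({t : T | h x t ≠ 0}).Countable) ↔
    (∃ (T : Type u) (h : X → T → unitInterval), Topology.IsEmbedding h ∧
      ∃ (Γ : Type u) (_ : PartialOrder Γ) (F : Γ → Set (T → unitInterval)) (ψ : Γ → Set T),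
        IsPiSkeleton (Set.range h) F ψ ∧ (⋃ s, F s) = Set.range h) := by
  constructor
  · rintro ⟨T, h, hh, hsupp⟩
    have hX := isCompact_range hh.continuous
    have hs : ∀ x ∈ Set.range h, (Function.support x).Countable := by
      rintro _ ⟨x, rfl⟩
      exact hsupp x
    exact ⟨T, h, hh, _, inferInstance, _, _, isPiSkeleton_pointsSupportedIn hX hs,
      iUnion_pointsSupportedIn hX hs⟩
  · rintro ⟨T, h, hh, Γ, _, F, ψ, hF, hfull⟩
    have hX := isCompact_range hh.continuous
    have : CompactSpace (Set.range h) := isCompact_iff_compactSpace.1 hX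
    obtain ⟨𝓕, hcont, hcount, hsep⟩ := hF.exists_pointCountable_separating hX hfull
    obtain ⟨T', g, hg, hsupp⟩ := exists_isEmbedding_countable_support 𝓕 hcont hcount hsep
    exact ⟨T', g ∘ hh.toHomeomorph, hg.comp hh.toHomeomorph.isEmbedding, fun x => hsupp _⟩
end

section
/- Let {X_i : i ∈ I} be a family of compact spaces with X_i ⊆ [0,1]^{T_i}, the sets T_i pairwise disjoint, such that each X_i carries a π-skeleton. Then the product Π_{i∈I} X_i, regarded via the canonical identification as a compact subspace of [0,1]^{⋃_{i∈I} T_i}, carries a π-skeleton. -/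
open Filter Topology


/-- The members of a π-skeleton on a compact set are compact. -/
theorem IsPiSkeleton.isCompact_s14 {T : Type*} {X : Set (T → unitInterval)} {Γ : Type*}
    [PartialOrder Γ] {F : Γ → Set (T → unitInterval)} {ψ : Γ → Set T}
    (h : IsPiSkeleton X F ψ) (hX : IsCompact X) (s : Γ) : IsCompact (F s) := by
  have hcont : Continuous fun x : T → unitInterval => (ψ s).domRestrict x :=
    continuous_pi fun t => continuous_apply t.1
  have him := h.image_eq s ▸ hX.image hcont
  rw [isCompact_iff_isCompact_univ, (h.embeds s).isCompact_iff]
  rw [Set.image_eq_range] at him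
  rwa [Set.image_univ]

/-- Second countability of a set on which a countable restriction map is an embedding. -/
theorem secondCountable_of_isEmbedding_restrict {T : Type*} {A : Set (T → unitInterval)}
    {S : Set T} (hS : S.Countable)
    (h : IsEmbedding (fun x : ↥A => S.domRestrict x.val)) : SecondCountableTopology ↥A := by
  have := hS.to_subtype
  exact h.secondCountableTopology

/-- A π-skeleton may be restricted to the indices above a given one. -/
theorem IsPiSkeleton.restrict_Ici {T : Type*} {X : Set (T → unitInterval)} {Γ : Type*}
    [PartialOrder Γ] {F : Γ → Set (T → unitInterval)} {ψ : Γ → Set T}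
    (h : IsPiSkeleton X F ψ) (a : Γ) :
    IsPiSkeleton X (fun s : Set.Ici a => F s) (fun s => ψ s) where
  directed s t := by
    obtain ⟨u, hu, hu'⟩ := h.directed s t
    exact ⟨⟨u, s.2.trans hu⟩, hu, hu'⟩
  sigma_complete f hf := by
    obtain ⟨u, hu⟩ := h.sigma_complete (fun n => f n) hf
    refine ⟨⟨u, (f 0).2.trans (hu.1 ⟨0, rfl⟩)⟩, ?_, fun v hv => hu.2 ?_⟩
    · rintro _ ⟨n, rfl⟩
      exact hu.1 ⟨n, rfl⟩
    · rintro _ ⟨n, rfl⟩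
      exact hv ⟨n, rfl⟩
  subset_X s := h.subset_X s
  cosmic s := h.cosmic s
  mono _ _ hst := h.mono hst
  dense := h.dense.trans <| closure_mono <| Set.iUnion_subset fun s => by
    obtain ⟨u, hu, hu'⟩ := h.directed s a
    exact (h.mono hu).trans (Set.subset_iUnion (fun s : Set.Ici a => F s) ⟨u, hu'⟩)
  countable s := h.countable s
  psi_mono _ _ hst := h.psi_mono hst
  psi_omega f hf u hu := by
    refine h.psi_omega (fun n => f n) hf u ⟨?_, fun v hv => ?_⟩
    · rintro _ ⟨n, rfl⟩
      exact hu.1 ⟨n, rfl⟩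
    · refine hu.2 (show (⟨v, (f 0).2.trans (hv ⟨0, rfl⟩)⟩ : Set.Ici a) ∈ _ from ?_)
      rintro _ ⟨n, rfl⟩
      exact hv ⟨n, rfl⟩
  embeds s := h.embeds s
  image_eq s := h.image_eq s

/-- A monotone sequence in `WithBot Γ` is constantly `⊥`, or a tail of it lies in `Γ`. -/
theorem WithBot.eq_bot_or_exists_tail {Γ : Type*} [PartialOrder Γ] {f : ℕ → WithBot Γ}
    (hf : Monotone f) :
    (∀ n, f n = ⊥) ∨ ∃ (N : ℕ) (g : ℕ → Γ), Monotone g ∧ ∀ n, f (n + N) = g n := by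
  by_cases hbot : ∀ n, f n = ⊥
  · exact .inl hbot
  push Not at hbot
  obtain ⟨N, hN⟩ := hbot
  have hne : ∀ n, ∃ a : Γ, f (n + N) = a := fun n => by
    have : f (n + N) ≠ ⊥ := fun h => hN (le_bot_iff.1 (h ▸ hf (Nat.le_add_left N n)))
    exact ⟨_, (WithBot.coe_unbot _ this).symm⟩
  choose g hg using hne
  refine .inr ⟨N, g, fun m n hmn => ?_, hg⟩
  rw [← WithBot.coe_le_coe, ← hg, ← hg]
  exact hf (by omega)

/-- Upper bounds of a monotone sequence are the upper bounds of any of its tails. -/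
theorem upperBounds_range_tail {α : Type*} [Preorder α] {f : ℕ → α} (hf : Monotone f) (N : ℕ) :
    upperBounds (Set.range f) = upperBounds (Set.range fun n => f (n + N)) := by
  ext u
  constructor
  · rintro h _ ⟨n, rfl⟩
    exact h ⟨_, rfl⟩
  · rintro h _ ⟨n, rfl⟩
    exact (hf (Nat.le_add_right n N)).trans (h ⟨n, rfl⟩)

/-- Passing from `Γ` to `WithBot Γ` preserves least upper bounds of nonempty ranges. -/
theorem WithBot.isLUB_range_coe {Γ ι : Type*} [PartialOrder Γ] [Nonempty ι] {g : ι → Γ} {u : Γ} :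
    IsLUB (Set.range fun n => (g n : WithBot Γ)) (u : WithBot Γ) ↔ IsLUB (Set.range g) u := by
  have i₀ : ι := Classical.arbitrary ι
  constructor
  · refine fun hu => ⟨?_, fun v hv => WithBot.coe_le_coe.1 (hu.2 ?_)⟩
    · rintro _ ⟨n, rfl⟩
      exact WithBot.coe_le_coe.1 (hu.1 ⟨n, rfl⟩)
    · rintro _ ⟨n, rfl⟩
      exact WithBot.coe_le_coe.2 (hv ⟨n, rfl⟩)
  · refine fun hu => ⟨?_, fun v hv => ?_⟩
    · rintro _ ⟨n, rfl⟩
      exact WithBot.coe_le_coe.2 (hu.1 ⟨n, rfl⟩)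
    · induction v with
      | bot => exact absurd (hv ⟨i₀, rfl⟩) (WithBot.not_coe_le_bot _)
      | coe v =>
        refine WithBot.coe_le_coe.2 (hu.2 ?_)
        rintro _ ⟨n, rfl⟩
        exact WithBot.coe_le_coe.1 (hv ⟨n, rfl⟩)

/-- A bottom index carrying a point common to all members can be adjoined to a π-skeleton. -/
theorem IsPiSkeleton.withBot {T : Type*} {X : Set (T → unitInterval)} {Γ : Type*}
    [PartialOrder Γ] {F : Γ → Set (T → unitInterval)} {ψ : Γ → Set T}
    (h : IsPiSkeleton X F ψ) {p : T → unitInterval} (hpX : p ∈ X) (hp : ∀ s, p ∈ F s) :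
    IsPiSkeleton X (WithBot.recBotCoe {p} F) (WithBot.recBotCoe ∅ ψ) where
  directed s t := by
    induction s with
    | bot => exact ⟨t, bot_le, le_rfl⟩
    | coe s =>
      induction t with
      | bot => exact ⟨s, le_rfl, bot_le⟩
      | coe t =>
        obtain ⟨u, hu, hu'⟩ := h.directed s t
        exact ⟨u, WithBot.coe_le_coe.2 hu, WithBot.coe_le_coe.2 hu'⟩
  sigma_complete f hf := by
    obtain hbot | ⟨N, g, hg, hfg⟩ := WithBot.eq_bot_or_exists_tail hf
    · refine ⟨⊥, ?_, fun _ _ => bot_le⟩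
      rintro _ ⟨n, rfl⟩
      exact (hbot n).le
    · obtain ⟨u, hu⟩ := h.sigma_complete g hg
      refine ⟨u, ?_⟩
      rw [IsLUB, upperBounds_range_tail hf N]
      simp only [hfg]
      exact WithBot.isLUB_range_coe.2 hu
  subset_X s := by
    induction s with
    | bot => exact Set.singleton_subset_iff.2 hpX
    | coe s => exact h.subset_X s
  cosmic s := by
    induction s with
    | bot =>
      change SecondCountableTopology ↥({p} : Set (T → unitInterval))
      infer_instance
    | coe s => exact h.cosmic s
  mono s t hst := by
    induction t with
    | bot => rw [le_bot_iff.1 hst]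
    | coe t =>
      induction s with
      | bot => exact Set.singleton_subset_iff.2 (hp t)
      | coe s => exact h.mono (WithBot.coe_le_coe.1 hst)
  dense := h.dense.trans <| closure_mono <| Set.iUnion_subset fun s _ hx =>
    Set.mem_iUnion.2 ⟨(s : WithBot Γ), hx⟩
  countable s := by
    induction s with
    | bot => exact Set.countable_empty
    | coe s => exact h.countable s
  psi_mono s t hst := by
    induction s with
    | bot => exact Set.empty_subset _
    | coe s =>
      induction t with
      | bot => exact absurd hst (WithBot.not_coe_le_bot _)
      | coe t => exact h.psi_mono (WithBot.coe_le_coe.1 hst)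
  psi_omega f hf u hu := by
    obtain hbot | ⟨N, g, hg, hfg⟩ := WithBot.eq_bot_or_exists_tail hf
    · have : u = ⊥ := le_bot_iff.1 <| hu.2 <| by
        rintro _ ⟨n, rfl⟩
        exact (hbot n).le
      simp [this, hbot]
    · have hu' := hu
      rw [IsLUB, upperBounds_range_tail hf N] at hu'
      simp only [hfg] at hu'
      induction u with
      | bot => exact absurd (hu'.1 ⟨0, rfl⟩) (WithBot.not_coe_le_bot _)
      | coe u =>
        have hψ := h.psi_omega g hg u (WithBot.isLUB_range_coe.1 hu')
        change ψ u = _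
        rw [hψ]
        refine Set.Subset.antisymm (Set.iUnion_subset fun n => ?_)
          (Set.iUnion_subset fun n => ?_)
        · refine Set.subset_iUnion_of_subset (n + N) ?_
          rw [hfg]
          exact subset_rfl
        · rw [← hψ]
          have hle := hu.1 ⟨n, rfl⟩
          generalize f n = a at hle
          induction a with
          | bot => exact Set.empty_subset _
          | coe a => exact h.psi_mono (WithBot.coe_le_coe.1 hle)
  embeds s := by
    induction s with
    | bot =>
      have : Subsingleton ↥(WithBot.recBotCoe {p} F (⊥ : WithBot Γ) :
          Set (T → unitInterval)) :=
        inferInstanceAs (Subsingleton ↥({p} : Set (T → unitInterval)))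
      exact .of_subsingleton _
    | coe s => exact h.embeds s
  image_eq s := by
    induction s with
    | bot =>
      have : IsEmpty ↥(WithBot.recBotCoe ∅ ψ (⊥ : WithBot Γ) : Set T) :=
        inferInstanceAs (IsEmpty ↥(∅ : Set T))
      refine Set.Subset.antisymm ?_ (Set.image_mono (Set.singleton_subset_iff.2 hpX))
      rintro _ ⟨x, -, rfl⟩
      exact ⟨p, rfl, Subsingleton.elim _ _⟩
    | coe s => exact h.image_eq s

/-- A nonempty set with a π-skeleton has one whose index set has a bottom element, sent to a
singleton and to the empty set of coordinates. -/
theorem IsPiSkeleton.exists_orderBot {T : Type*} {X : Set (T → unitInterval)} {Γ : Type u}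
    [PartialOrder Γ] {F : Γ → Set (T → unitInterval)} {ψ : Γ → Set T}
    (h : IsPiSkeleton X F ψ) (hX : X.Nonempty) :
    ∃ (Γ' : Type u) (_ : PartialOrder Γ') (_ : OrderBot Γ')
      (F' : Γ' → Set (T → unitInterval)) (ψ' : Γ' → Set T) (p : T → unitInterval),
      IsPiSkeleton X F' ψ' ∧ F' ⊥ = {p} ∧ ψ' ⊥ = ∅ := by
  obtain ⟨p, hp⟩ := closure_nonempty_iff.1 (hX.mono h.dense)
  obtain ⟨a, ha⟩ := Set.mem_iUnion.1 hp
  exact ⟨WithBot (Set.Ici a), inferInstance, inferInstance, _, _, p,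
    (h.restrict_Ici a).withBot (h.subset_X a ha) fun s => h.mono s.2 ha, rfl, rfl⟩

/-- Currying of functions on a sigma type, as a homeomorphism. -/
def sigmaCurryHomeomorph {I : Type*} (T : I → Type*) (Y : Type*) [TopologicalSpace Y] :
    ((Σ i, T i) → Y) ≃ₜ (∀ i, T i → Y) where
  toEquiv := Equiv.piCurry fun _ _ => Y
  continuous_toFun := continuous_pi fun i => continuous_pi fun t =>
    continuous_apply (⟨i, t⟩ : Σ i, T i)
  continuous_invFun := continuous_pi fun t => (continuous_apply t.2).comp (continuous_apply t.1)

section Product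

variable {I : Type*} {T : I → Type*} {Γ : I → Type*} [∀ i, PartialOrder (Γ i)]
  [∀ i, OrderBot (Γ i)]

/-- The elements of a product of pointed posets with countable support. -/
abbrev CountableSupport (Γ : I → Type*) [∀ i, PartialOrder (Γ i)] [∀ i, OrderBot (Γ i)] :=
  {s : ∀ i, Γ i // {i | s i ≠ ⊥}.Countable}

/-- Coordinatewise least upper bounds of a sequence of countably supported elements have
countable support. -/
theorem CountableSupport.countable_of_isLUB {f : ℕ → CountableSupport Γ} {u : ∀ i, Γ i}
    (hu : ∀ i, IsLUB (Set.range fun n => (f n).1 i) (u i)) : {i | u i ≠ ⊥}.Countable := by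
  refine (Set.countable_iUnion fun n => (f n).2).mono fun i hi => ?_
  by_contra hcon
  simp only [Set.mem_iUnion, Set.mem_ofPred_eq, not_exists, not_not] at hcon
  refine hi (le_bot_iff.1 ((hu i).2 ?_))
  rintro _ ⟨n, rfl⟩
  exact (hcon n).le

/-- Coordinatewise least upper bounds are least upper bounds. -/
theorem CountableSupport.isLUB_of_forall {f : ℕ → CountableSupport Γ} {u : CountableSupport Γ}
    (hu : ∀ i, IsLUB (Set.range fun n => (f n).1 i) (u.1 i)) : IsLUB (Set.range f) u := by
  refine ⟨?_, fun v hv i => (hu i).2 ?_⟩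
  · rintro _ ⟨n, rfl⟩ i
    exact (hu i).1 ⟨n, rfl⟩
  · rintro _ ⟨n, rfl⟩
    exact hv ⟨n, rfl⟩ i

/-- The product of π-skeletons with bottom indices is indexed by the countably supported elements
of the product of the index sets. -/
theorem IsPiSkeleton.prod {X : ∀ i, Set (T i → unitInterval)}
    {F : ∀ i, Γ i → Set (T i → unitInterval)} {ψ : ∀ i, Γ i → Set (T i)}
    (hcomp : ∀ i, IsCompact (X i)) (h : ∀ i, IsPiSkeleton (X i) (F i) (ψ i))
    {p : ∀ i, T i → unitInterval} (hF : ∀ i, F i ⊥ = {p i}) (hψ : ∀ i, ψ i ⊥ = ∅) :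
    IsPiSkeleton {x : (Σ i, T i) → unitInterval | ∀ i, (fun t => x ⟨i, t⟩) ∈ X i}
      (fun s : CountableSupport Γ => {x | ∀ i, (fun t => x ⟨i, t⟩) ∈ F i (s.1 i)})
      (fun s => {t | t.2 ∈ ψ t.1 (s.1 t.1)}) := by
  classical
  have hlub : ∀ f : ℕ → CountableSupport Γ, Monotone f → ∃ u : CountableSupport Γ,
      ∀ i, IsLUB (Set.range fun n => (f n).1 i) (u.1 i) := fun f hf => by
    choose u hu using fun i => (h i).sigma_complete (fun n => (f n).1 i) fun m n hmn => hf hmn i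
    exact ⟨⟨u, CountableSupport.countable_of_isLUB hu⟩, hu⟩
  have hcount : ∀ s : CountableSupport Γ,
      {t : Σ i, T i | t.2 ∈ ψ t.1 (s.1 t.1)}.Countable := fun s => by
    refine (s.2.biUnion fun i _ => ((h i).countable (s.1 i)).image (Sigma.mk i)).mono ?_
    rintro ⟨i, t⟩ ht
    have hi : s.1 i ≠ ⊥ := fun hi => by
      change t ∈ ψ i (s.1 i) at ht
      simp [hi, hψ] at ht
    exact Set.mem_biUnion hi ⟨t, ht, rfl⟩
  have hembeds : ∀ s : CountableSupport Γ, IsEmbedding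
      (fun x : ↥{x : (Σ i, T i) → unitInterval | ∀ i, (fun t => x ⟨i, t⟩) ∈ F i (s.1 i)} =>
        {t : Σ i, T i | t.2 ∈ ψ t.1 (s.1 t.1)}.domRestrict x.val) := fun s => by
    have hK : IsCompact
        {x : (Σ i, T i) → unitInterval | ∀ i, (fun t => x ⟨i, t⟩) ∈ F i (s.1 i)} := by
      have hpi := isCompact_univ_pi fun i => (h i).isCompact_s14 (hcomp i) (s.1 i)
      convert (sigmaCurryHomeomorph T unitInterval).isCompact_preimage.2 hpi using 1
      ext x
      simp only [Set.mem_ofPred_eq, Set.mem_preimage, Set.mem_univ_pi]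
      rfl
    have := isCompact_iff_compactSpace.1 hK
    refine (Continuous.isClosedEmbedding ?_ ?_).isEmbedding
    · exact continuous_pi fun t => (continuous_apply t.1).comp continuous_subtype_val
    · intro x y hxy
      ext ⟨i, t⟩ : 2
      have hi := (h i).embeds (s.1 i) |>.injective
        (a₁ := ⟨_, x.2 i⟩) (a₂ := ⟨_, y.2 i⟩)
        (funext fun t => congrFun hxy ⟨⟨i, t.1⟩, t.2⟩)
      exact congrFun (congrArg Subtype.val hi) t
  have hsub : ∀ s : CountableSupport Γ,
      {x : (Σ i, T i) → unitInterval | ∀ i, (fun t => x ⟨i, t⟩) ∈ F i (s.1 i)} ⊆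
        {x | ∀ i, (fun t => x ⟨i, t⟩) ∈ X i} := fun s x hx i => (h i).subset_X _ (hx i)
  refine
    { directed := fun s t => ?_
      sigma_complete := fun f hf => ?_
      subset_X := hsub
      cosmic := fun s => secondCountable_of_isEmbedding_restrict (hcount s) (hembeds s)
      mono := fun s t hst x hx i => (h i).mono (hst i) (hx i)
      dense := fun x hx => ?_
      countable := hcount
      psi_mono := fun s t hst a ha => (h a.1).psi_mono (hst a.1) ha
      psi_omega := fun f hf u hu => ?_
      embeds := hembeds
      image_eq := fun s => ?_ }
  · choose u hu hu' using fun i => (h i).directed (s.1 i) (t.1 i)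
    refine ⟨⟨fun i => if s.1 i = ⊥ ∧ t.1 i = ⊥ then ⊥ else u i,
      (s.2.union t.2).mono fun i hi => ?_⟩, fun i => ?_, fun i => ?_⟩
    · by_contra hcon
      simp only [Set.mem_union, Set.mem_ofPred_eq, not_or, not_not] at hcon
      exact hi (if_pos hcon)
    · dsimp only
      split_ifs with hi
      exacts [hi.1.le, hu i]
    · dsimp only
      split_ifs with hi
      exacts [hi.2.le, hu' i]
  · obtain ⟨u, hu⟩ := hlub f hf
    exact ⟨u, CountableSupport.isLUB_of_forall hu⟩
  · let e := sigmaCurryHomeomorph T unitInterval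
    suffices hx' : e x ∈ closure (e.symm ⁻¹' ⋃ s : CountableSupport Γ,
        {x | ∀ i, (fun t => x ⟨i, t⟩) ∈ F i (s.1 i)}) by
      rw [← e.symm.preimage_closure] at hx'
      simpa using hx'
    rw [mem_closure_iff_nhds]
    intro V hV
    rw [nhds_pi, Filter.mem_pi] at hV
    obtain ⟨J, hJ, U, hU, hUV⟩ := hV
    have hex : ∀ i, ∃ y ∈ U i, ∃ s, y ∈ F i s := fun i => by
      obtain ⟨y, hy, hy'⟩ := mem_closure_iff_nhds.1 ((h i).dense (hx i)) (U i) (hU i)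
      exact ⟨y, hy, Set.mem_iUnion.1 hy'⟩
    choose y hyU s hys using hex
    refine ⟨fun i => if i ∈ J then y i else p i, hUV fun i hi => ?_, Set.mem_iUnion.2
      ⟨⟨fun i => if i ∈ J then s i else ⊥, hJ.countable.mono fun i hi => ?_⟩, fun i => ?_⟩⟩
    · simpa only [if_pos hi] using hyU i
    · by_contra hcon
      exact hi (if_neg hcon)
    · change (if i ∈ J then y i else p i) ∈ F i (if i ∈ J then s i else ⊥)
      split_ifs
      exacts [hys i, hF i ▸ rfl]
  · obtain ⟨v, hv⟩ := hlub f hf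
    obtain rfl := hu.unique (CountableSupport.isLUB_of_forall hv)
    ext ⟨i, t⟩
    simp [(h i).psi_omega (fun n => (f n).1 i) (fun m n hmn => hf hmn i) _ (hv i)]
  · refine Set.Subset.antisymm ?_ (Set.image_mono (hsub s))
    rintro _ ⟨x, hx, rfl⟩
    have hex : ∀ i, ∃ y ∈ F i (s.1 i),
        (ψ i (s.1 i)).domRestrict y = (ψ i (s.1 i)).domRestrict fun t => x ⟨i, t⟩ := fun i =>
      ((h i).image_eq (s.1 i)).subset (Set.mem_image_of_mem _ (hx i))
    choose y hy hyx using hex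
    exact ⟨fun t => y t.1 t.2, hy, funext fun t => congrFun (hyx t.1.1) ⟨t.1.2, t.2⟩⟩

end Product

/-- The empty set carries a trivial π-skeleton. -/
theorem IsPiSkeleton.empty (T : Type*) :
    IsPiSkeleton (∅ : Set (T → unitInterval)) (fun _ : PEmpty => ∅) (fun _ => ∅) where
  directed s := s.elim
  sigma_complete f := (f 0).elim
  subset_X s := s.elim
  cosmic s := s.elim
  mono s := s.elim
  dense := Set.empty_subset _
  countable s := s.elim
  psi_mono s := s.elim
  psi_omega f := (f 0).elim
  embeds s := s.elim
  image_eq s := s.elim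

/-- Theorem 5.11: the product of compact spaces with π-skeletons, viewed
canonically inside `[0,1]^{⨆ i, T i}`, carries a π-skeleton. -/
theorem statement14 {I : Type u} {T : I → Type u}
    (X : ∀ i : I, Set (T i → unitInterval)) (hcomp : ∀ i, IsCompact (X i))
    (hskel : ∀ i : I, ∃ (Γ : Type u) (_ : PartialOrder Γ)
      (F : Γ → Set (T i → unitInterval)) (ψ : Γ → Set (T i)), IsPiSkeleton (X i) F ψ) :
    ∃ (Γ : Type u) (_ : PartialOrder Γ)
      (F : Γ → Set ((Σ i : I, T i) → unitInterval)) (ψ : Γ → Set (Σ i : I, T i)),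
      IsPiSkeleton {x : (Σ i : I, T i) → unitInterval |
        ∀ i : I, (fun t : T i => x ⟨i, t⟩) ∈ X i} F ψ := by
  by_cases hne : ∀ i, (X i).Nonempty
  · choose Γ₀ _ F₀ ψ₀ h₀ using hskel
    choose Γ _ _ F ψ p h hF hψ using fun i => (h₀ i).exists_orderBot (hne i)
    exact ⟨_, inferInstance, _, _, IsPiSkeleton.prod hcomp h hF hψ⟩
  · push Not at hne
    obtain ⟨i, hi⟩ := hne
    refine ⟨PEmpty, inferInstance, fun _ => ∅, fun _ => ∅, ?_⟩
    convert IsPiSkeleton.empty (Σ i, T i) using 1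
    exact Set.eq_empty_of_forall_notMem fun x hx => by simpa [hi] using hx i
end

section
/- Let X be a compact Hausdorff space and F ⊆ X a closed subspace that is second countable. The following are equivalent: (1) there exists a countable family ℬ of open subsets of X such that ℬ is a base for a topology on X, {U ∩ F : U ∈ ℬ} is a base for the subspace topology of F, U ∩ F ≠ ∅ for every U ∈ ℬ, and the following holds: for every x ∈ X and every z ∈ ⋂_{U ∈ N(ℬ,x)} cl(U ∩ F), for each V ∈ N(ℬ,z) there is U ∈ N(ℬ,x) with cl(U ∩ F) ⊆ V; (2) there exists a continuous retraction r : X → F, i.e., a continuous map r : X → X with r(X) = F and r(x) = x for every x ∈ F. -/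
open Filter Topology

/-- If traces of `B` on a closed subset `F` shrink, in the sense of the last hypothesis, then
the sets `closure (U ∩ F)`, `x ∈ U ∈ B`, single out a continuous retraction onto `F`. -/
theorem exists_retraction_of_base {X : Type*} [TopologicalSpace X] [CompactSpace X] [T2Space X]
    {F : Set X} (hF : IsClosed F) {B : Set (Set X)} (hopen : ∀ U ∈ B, IsOpen U)
    (hcov : ⋃₀ B = Set.univ)
    (hinter : ∀ U ∈ B, ∀ V ∈ B, ∀ x ∈ U ∩ V, ∃ W ∈ B, x ∈ W ∧ W ⊆ U ∩ V)
    (hbase : ∀ x ∈ F, ∀ V : Set X, IsOpen V → x ∈ V → ∃ U ∈ B, x ∈ U ∧ U ∩ F ⊆ V)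
    (hne : ∀ U ∈ B, (U ∩ F).Nonempty)
    (hshrink : ∀ x : X, ∀ z ∈ ⋂ U ∈ {U | U ∈ B ∧ x ∈ U}, closure (U ∩ F),
      ∀ V ∈ B, z ∈ V → ∃ U ∈ B, x ∈ U ∧ closure (U ∩ F) ⊆ V) :
    ∃ r : X → X, Continuous r ∧ Set.range r = F ∧ ∀ x ∈ F, r x = x := by
  have hsub (U : Set X) : closure (U ∩ F) ⊆ F :=
    closure_minimal Set.inter_subset_right hF
  have hex (x : X) : ∃ U ∈ B, x ∈ U := Set.mem_sUnion.1 (hcov ▸ Set.mem_univ x)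
  have hK (x : X) : ∃ z, ∀ U ∈ B, x ∈ U → z ∈ closure (U ∩ F) := by
    obtain ⟨U₀, hU₀, hxU₀⟩ := hex x
    have : Nonempty {U | U ∈ B ∧ x ∈ U} := ⟨⟨U₀, hU₀, hxU₀⟩⟩
    obtain ⟨z, hz⟩ := IsCompact.nonempty_iInter_of_directed_nonempty_isCompact_isClosed
      (fun U : {U | U ∈ B ∧ x ∈ U} => closure ((U : Set X) ∩ F))
      (by
        rintro ⟨U, hU, hxU⟩ ⟨V, hV, hxV⟩
        obtain ⟨W, hW, hxW, hWUV⟩ := hinter U hU V hV x ⟨hxU, hxV⟩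
        exact ⟨⟨W, hW, hxW⟩,
          closure_mono (Set.inter_subset_inter_left F (hWUV.trans Set.inter_subset_left)),
          closure_mono (Set.inter_subset_inter_left F (hWUV.trans Set.inter_subset_right))⟩)
      (fun U => (hne U U.2.1).closure) (fun U => isClosed_closure.isCompact)
      (fun U => isClosed_closure)
    exact ⟨z, fun U hU hxU => Set.mem_iInter.1 hz ⟨U, hU, hxU⟩⟩
  choose r hr using hK
  have hrF (x : X) : r x ∈ F := by
    obtain ⟨U, hU, hxU⟩ := hex x
    exact hsub U (hr x U hU hxU)
  have hnhds (x : X) (O : Set X) (hO : IsOpen O) (hxO : r x ∈ O) :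
      ∃ U ∈ B, x ∈ U ∧ closure (U ∩ F) ⊆ O := by
    obtain ⟨V, hV, hxV, hVO⟩ := hbase (r x) (hrF x) O hO hxO
    obtain ⟨U, hU, hxU, hUV⟩ := hshrink x (r x)
      (Set.mem_iInter₂.2 fun U hU => hr x U hU.1 hU.2) V hV hxV
    exact ⟨U, hU, hxU, fun y hy => hVO ⟨hUV hy, hsub U hy⟩⟩
  have hid (x : X) (hx : x ∈ F) : r x = x := by
    by_contra h
    obtain ⟨U, -, hxU, hUO⟩ := hnhds x {x}ᶜ isOpen_compl_singleton h
    exact hUO (subset_closure ⟨hxU, hx⟩) rfl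
  refine ⟨r, continuous_iff_continuousAt.2 fun x => ?_, ?_, hid⟩
  · refine (nhds_basis_opens (r x)).tendsto_right_iff.2 fun O ⟨hxO, hO⟩ => ?_
    obtain ⟨U, hU, hxU, hUO⟩ := hnhds x O hO hxO
    filter_upwards [(hopen U hU).mem_nhds hxU] with y hy using hUO (hr y U hU hy)
  · exact Set.Subset.antisymm (Set.range_subset_iff.2 hrF) fun x hx => ⟨x, hid x hx⟩

/-- Lemma 6.2: for a closed cosmic (second countable) subspace `F` of a compact
Hausdorff space `X`, `F` is a retract of `X` iff there is a countable family `B` of open sets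
which is a base for a topology on `X`, whose traces form a base for `F`, all meeting `F`, and
satisfying condition (3) of the weak c-skeleton definition. -/
theorem statement16 {X : Type*} [TopologicalSpace X] [CompactSpace X] [T2Space X]
    (F : Set X) (hF : IsClosed F) (hsc : SecondCountableTopology ↥F) :
    (∃ B : Set (Set X), B.Countable ∧ (∀ U ∈ B, IsOpen U) ∧
      -- `B` is a base for a topology on `X`:
      (⋃₀ B = Set.univ ∧
        ∀ U ∈ B, ∀ V ∈ B, ∀ x ∈ U ∩ V, ∃ W ∈ B, x ∈ W ∧ W ⊆ U ∩ V) ∧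
      -- `B|_F` is a base for the subspace topology of `F`:
      (∀ x ∈ F, ∀ V : Set X, IsOpen V → x ∈ V → ∃ U ∈ B, x ∈ U ∧ U ∩ F ⊆ V) ∧
      -- every member of `B` meets `F`:
      (∀ U ∈ B, (U ∩ F).Nonempty) ∧
      -- condition (3) of the weak c-skeleton definition:
      (∀ x : X, ∀ z ∈ ⋂ U ∈ {U | U ∈ B ∧ x ∈ U}, closure (U ∩ F),
        ∀ V ∈ B, z ∈ V → ∃ U ∈ B, x ∈ U ∧ closure (U ∩ F) ⊆ V)) ↔
    (∃ r : X → X, Continuous r ∧ Set.range r = F ∧ ∀ x ∈ F, r x = x) := by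
  constructor
  · rintro ⟨B, -, hopen, ⟨hcov, hinter⟩, hbase, hne, hshrink⟩
    exact exists_retraction_of_base hF hopen hcov hinter hbase hne hshrink
  · rintro ⟨r, hr, hrange, hid⟩
    have hrF (x : X) : r x ∈ F := hrange ▸ Set.mem_range_self x
    let ρ : X → F := fun x => ⟨r x, hrF x⟩
    have hρ : Continuous ρ := hr.subtype_mk hrF
    have hρid (y : F) : ρ y = y := Subtype.ext (hid y y.2)
    have htrace (W : Set F) : ρ ⁻¹' W ∩ F = Subtype.val '' W := by
      ext y
      constructor
      · rintro ⟨hy, hyF⟩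
        exact ⟨ρ y, hy, hid y hyF⟩
      · rintro ⟨y, hy, rfl⟩
        exact ⟨by rwa [Set.mem_preimage, hρid], y.2⟩
    have hcl (W : Set F) : closure (ρ ⁻¹' W ∩ F) = Subtype.val '' closure W := by
      rw [htrace, hF.isClosedEmbedding_subtypeVal.closure_image_eq]
    have hb := TopologicalSpace.isBasis_countableBasis F
    have hmem (y : F) (O : Set F) (hO : IsOpen O) (hy : y ∈ O) :
        ∃ W ∈ TopologicalSpace.countableBasis F, y ∈ W ∧ W ⊆ O :=
      hb.exists_subset_of_mem_open hy hO
    have hclmem (y : F) (O : Set F) (hO : IsOpen O) (hy : y ∈ O) :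
        ∃ W ∈ TopologicalSpace.countableBasis F, y ∈ W ∧ closure W ⊆ O :=
      hb.exists_closure_subset (hO.mem_nhds hy)
    refine ⟨Set.preimage ρ '' TopologicalSpace.countableBasis F,
      (TopologicalSpace.countable_countableBasis F).image _, ?_, ⟨?_, ?_⟩, ?_, ?_, ?_⟩
    · rintro _ ⟨W, hW, rfl⟩
      exact (hb.isOpen hW).preimage hρ
    · refine Set.eq_univ_of_forall fun x => ?_
      obtain ⟨W, hW, hxW, -⟩ := hmem (ρ x) Set.univ isOpen_univ trivial
      exact ⟨_, ⟨W, hW, rfl⟩, hxW⟩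
    · rintro _ ⟨U, hU, rfl⟩ _ ⟨V, hV, rfl⟩ x hx
      obtain ⟨W, hW, hxW, hWUV⟩ := hmem (ρ x) (U ∩ V) ((hb.isOpen hU).inter (hb.isOpen hV)) hx
      exact ⟨_, ⟨W, hW, rfl⟩, hxW, Set.preimage_mono hWUV⟩
    · intro x hx V hV hxV
      obtain ⟨W, hW, hxW, hWV⟩ :=
        hmem ⟨x, hx⟩ (Subtype.val ⁻¹' V) (hV.preimage continuous_subtype_val) hxV
      refine ⟨_, ⟨W, hW, rfl⟩, ?_, ?_⟩
      · rwa [Set.mem_preimage, hρid ⟨x, hx⟩]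
      · rw [htrace]
        exact Set.image_subset_iff.2 hWV
    · rintro _ ⟨W, hW, rfl⟩
      rw [htrace]
      exact (TopologicalSpace.nonempty_of_mem_countableBasis hW).image _
    · rintro x z hz _ ⟨W', hW', rfl⟩ hzW'
      have hz' (W : Set F) (hW : W ∈ TopologicalSpace.countableBasis F) (hxW : ρ x ∈ W) :
          z ∈ Subtype.val '' closure W :=
        hcl W ▸ Set.mem_iInter₂.1 hz _ ⟨⟨W, hW, rfl⟩, hxW⟩
      have hzx : ρ z = ρ x := by
        by_contra h
        obtain ⟨W, hW, hxW, hWc⟩ := hclmem (ρ x) {ρ z}ᶜ isOpen_compl_singleton (Ne.symm h)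
        obtain ⟨y, hy, rfl⟩ := hz' W hW hxW
        exact hWc hy (hρid y).symm
      obtain ⟨W, hW, hxW, hWW'⟩ := hclmem (ρ x) W' (hb.isOpen hW') (hzx ▸ hzW')
      refine ⟨_, ⟨W, hW, rfl⟩, hxW, ?_⟩
      rw [hcl]
      rintro _ ⟨y, hy, rfl⟩
      rw [Set.mem_preimage, hρid]
      exact hWW' hy
end
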